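/- (Traynor) Let Λ₀ and Λ₁ be the Legendrian knots Λ₀(x) = (x,0,0) and Λ₁(x) = (x,0,1). There is NO Legendrian isotopy of ordered Legendrian links from (Λ₀, Λ₁) to (Λ₁, Λ₀); that is, there do not exist smooth maps H⁰, H¹ : ℝ × ℝ → ℝ³ such that for each t ∈ [0,1] the pair (H⁰(t,·), H¹(t,·)) is an ordered Legendrian link, (H⁰(0,·), H¹(0,·)) = (Λ₀, Λ₁), the image of H⁰(1,·) is {(x,0,1) : x ∈ ℝ}, and the image of H¹(1,·) is {(x,0,0) : x ∈ ℝ}. -/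

import Mathlib

open Real

/-- A spinning loop: smooth map ℝ → ℝ³ equivariant under the deck
transformation (translation by 2π in the x-coordinate). -/
def SpinningLoop (γ : ℝ → ℝ × ℝ × ℝ) : Prop :=
  ContDiff ℝ (⊤ : ℕ∞) γ ∧ ∀ x, γ (x + 2 * π) = γ x + (2 * π, 0, 0)

/-- An embedded spinning loop: an immersion, injective modulo the deck action. -/
def EmbeddedSpinningLoop (γ : ℝ → ℝ × ℝ × ℝ) : Prop :=
  SpinningLoop γ ∧ (∀ x, deriv γ x ≠ 0) ∧
    ∀ x x', γ x = γ x' → ∃ k : ℤ, x - x' = 2 * π * k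

/-- A Legendrian knot: an embedded spinning loop tangent to ker(dz - y dx). -/
def LegendrianKnot (γ : ℝ → ℝ × ℝ × ℝ) : Prop :=
  EmbeddedSpinningLoop γ ∧
    ∀ x, deriv (fun s => (γ s).2.2) x = (γ x).2.1 * deriv (fun s => (γ s).1) x

/-- An ordered Legendrian link: two Legendrian knots with disjoint images. -/
def OrderedLegendrianLink (L₀ L₁ : ℝ → ℝ × ℝ × ℝ) : Prop :=
  LegendrianKnot L₀ ∧ LegendrianKnot L₁ ∧ Disjoint (Set.range L₀) (Set.range L₁)

/-- For an endomorphism `A`, the function `t ↦ det (1 + t A)` is a polynomial of degree at most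
the dimension. -/
theorem exists_polynomial_det_one_add_smul {E : Type*} [NormedAddCommGroup E] [NormedSpace ℝ E]
    [FiniteDimensional ℝ E] (A : E →L[ℝ] E) :
    ∃ p : Polynomial ℝ, p.natDegree ≤ Module.finrank ℝ E ∧
      ∀ t : ℝ, p.eval t = (1 + t • A).det := by
  classical
  let b := Module.finBasis ℝ E
  let M := LinearMap.toMatrix b b (A : E →ₗ[ℝ] E)
  refine ⟨((Polynomial.X : Polynomial ℝ) • M.map Polynomial.C
    + (1 : Matrix _ _ ℝ).map Polynomial.C).det, ?_, fun t => ?_⟩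
  · simpa using Polynomial.natDegree_det_X_add_C_le M 1
  · have h1 : (1 + t • A).det = LinearMap.det ((1 + t • A : E →L[ℝ] E) : E →ₗ[ℝ] E) := rfl
    rw [h1, ← LinearMap.det_toMatrix b, ← Polynomial.coe_evalRingHom, RingHom.map_det]
    have h2 : ((1 + t • A : E →L[ℝ] E) : E →ₗ[ℝ] E) = 1 + t • (A : E →ₗ[ℝ] E) := rfl
    rw [h2, map_add (LinearMap.toMatrix b b), map_smul (LinearMap.toMatrix b b),
      LinearMap.toMatrix_one]
    congr 1
    ext i j
    simp only [RingHom.mapMatrix_apply, Matrix.map_apply, Matrix.add_apply, Matrix.smul_apply,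
      Polynomial.coe_evalRingHom, Polynomial.eval_add, smul_eq_mul,
      Polynomial.eval_mul, Polynomial.eval_X, Polynomial.eval_C]
    rw [add_comm]

open MeasureTheory Metric in
/-- A compactly supported perturbation of the identity that is small in `C¹` permutes the ball
containing its support, hence preserves its volume. -/
theorem eventually_integral_det_one_add_smul {E : Type*} [NormedAddCommGroup E]
    [NormedSpace ℝ E] [FiniteDimensional ℝ E] [MeasurableSpace E] [BorelSpace E]
    (μ : Measure E) [μ.IsAddHaarMeasure] {g : E → E} (hg : ContDiff ℝ 1 g) {r : ℝ}
    (hsupp : ∀ w, r ≤ ‖w‖ → g w = 0) :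
    ∃ t₀ > 0, ∀ t ∈ Set.Ioo (0 : ℝ) t₀,
      ∫ w in ball (0 : E) r, (1 + t • fderiv ℝ g w).det ∂μ = μ.real (ball (0 : E) r) := by
  have hcs : HasCompactSupport g := by
    refine HasCompactSupport.of_support_subset_isCompact (isCompact_closedBall (0 : E) r) ?_
    intro w hw
    by_contra h
    exact hw (hsupp w (by simpa using (not_le.1 (by simpa using h)).le))
  obtain ⟨K, hK⟩ := hg.lipschitzWith_of_hasCompactSupport hcs one_ne_zero
  have hdet : ∀ᶠ A : E →L[ℝ] E in nhds 0, 0 < (1 + A).det := by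
    have hc : ContinuousAt (fun A : E →L[ℝ] E => (1 + A).det) 0 :=
      (ContinuousLinearMap.continuous_det.comp (by fun_prop)).continuousAt
    refine hc.eventually_mem (Ioi_mem_nhds ?_)
    have : ((1 : E →L[ℝ] E) + 0).det = 1 := by
      rw [add_zero]; exact LinearMap.det_id
    rw [this]; exact one_pos
  obtain ⟨ρ, hρ, hρ'⟩ := Metric.eventually_nhds_iff.1 hdet
  have hK1 : (0 : ℝ) < K + 1 := by positivity
  refine ⟨min (1 / (K + 1)) (ρ / (K + 1)), by positivity, fun t ht => ?_⟩
  have ht0 := ht.1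
  have ht1 : t * (K + 1) < 1 := (lt_div_iff₀ hK1).1 (ht.2.trans_le (min_le_left _ _))
  have ht2 : t * (K + 1) < ρ := (lt_div_iff₀ hK1).1 (ht.2.trans_le (min_le_right _ _))
  have htK : t * K < 1 := by linarith
  let f : E → E := fun w => w + t • g w
  have hf : ∀ w, HasFDerivAt f (1 + t • fderiv ℝ g w) w := fun w =>
    (hasFDerivAt_id w).add (((hg.differentiable one_ne_zero) w).hasFDerivAt.const_smul t)
  have hpos : ∀ w, 0 < (1 + t • fderiv ℝ g w).det := fun w => by
    apply hρ'
    rw [dist_zero_right, norm_smul, Real.norm_of_nonneg ht0.le]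
    have := norm_fderiv_le_of_lipschitz ℝ hK (x₀ := w)
    nlinarith
  have hinj : Function.Injective f := fun a b hab => by
    have h1 : a - b = t • (g b - g a) := by
      have : a + t • g a = b + t • g b := hab
      rw [smul_sub, sub_eq_sub_iff_add_eq_add, this]; abel
    have h2 : ‖a - b‖ ≤ t * (K * ‖a - b‖) := by
      calc ‖a - b‖ = t * ‖g b - g a‖ := by
            conv_lhs => rw [h1]
            rw [norm_smul, Real.norm_of_nonneg ht0.le]
        _ ≤ t * (K * ‖a - b‖) := by
            gcongr
            have := hK.dist_le_mul b a
            rwa [dist_eq_norm, dist_eq_norm, norm_sub_rev b a] at this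
    have h3 : ‖a - b‖ = 0 := by nlinarith [norm_nonneg (a - b)]
    exact sub_eq_zero.1 (norm_eq_zero.1 h3)
  have hsurj : Function.Surjective f := fun y => by
    have hcw : ContractingWith (t.toNNReal * K) (fun w => y - t • g w) := by
      refine ⟨?_, ?_⟩
      · rw [← NNReal.coe_lt_coe]
        simpa [ht0.le] using htK
      · refine LipschitzWith.of_dist_le_mul fun a b => ?_
        rw [dist_sub_left, dist_smul₀, Real.norm_of_nonneg ht0.le, NNReal.coe_mul,
          Real.coe_toNNReal _ ht0.le, mul_assoc]
        gcongr
        exact hK.dist_le_mul a b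
    refine ⟨hcw.fixedPoint _, ?_⟩
    have := hcw.fixedPoint_isFixedPt
    have h : y - t • g (hcw.fixedPoint _) = hcw.fixedPoint _ := this
    exact (sub_eq_iff_eq_add.1 h).symm
  have hid : ∀ w, r ≤ ‖w‖ → f w = w := fun w hw => by simp [f, hsupp w hw]
  have himg : f '' ball 0 r = ball 0 r := by
    ext y
    constructor
    · rintro ⟨w, hw, rfl⟩
      by_contra h
      have h1 := hid (f w) (by simpa using h)
      exact h (by rw [hinj h1]; exact hw)
    · intro hy
      obtain ⟨w, rfl⟩ := hsurj y
      refine ⟨w, ?_, rfl⟩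
      by_contra h
      rw [hid w (by simpa using h)] at hy
      exact h hy
  have key := integral_image_eq_integral_abs_det_fderiv_smul μ measurableSet_ball
    (fun w _ => (hf w).hasFDerivWithinAt) hinj.injOn (fun _ => (1 : ℝ)) (s := ball 0 r)
  rw [himg] at key
  simp only [integral_const, smul_eq_mul, mul_one, abs_of_pos (hpos _)] at key
  rw [← key]
  simp

open MeasureTheory Metric in
/-- The Jacobian integral of a compactly supported perturbation of the identity is the volume. -/
theorem integral_det_one_add_fderiv {E : Type*} [NormedAddCommGroup E]
    [NormedSpace ℝ E] [FiniteDimensional ℝ E] [MeasurableSpace E] [BorelSpace E]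
    (μ : Measure E) [μ.IsAddHaarMeasure] {g : E → E} (hg : ContDiff ℝ 1 g) {r : ℝ}
    (hsupp : ∀ w, r ≤ ‖w‖ → g w = 0) :
    ∫ w in ball (0 : E) r, (1 + fderiv ℝ g w).det ∂μ = μ.real (ball (0 : E) r) := by
  obtain ⟨t₀, ht₀, H⟩ := eventually_integral_det_one_add_smul μ hg hsupp
  set n := Module.finrank ℝ E
  let s := Finset.range (n + 1)
  let v : ℕ → ℝ := fun i => t₀ / (i + 2)
  have hv : ∀ i, v i ∈ Set.Ioo 0 t₀ := fun i => by
    refine ⟨by positivity, ?_⟩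
    rw [div_lt_iff₀ (by positivity)]
    nlinarith [(Nat.cast_nonneg i : (0 : ℝ) ≤ i)]
  have hvinj : Set.InjOn v s := fun i _ j _ hij => by
    have h : t₀ / ((i : ℝ) + 2) = t₀ / ((j : ℝ) + 2) := hij
    rw [div_eq_div_iff (by positivity) (by positivity)] at h
    exact_mod_cast (add_right_cancel (mul_left_cancel₀ ht₀.ne' h)).symm
  have hexp : ∀ w, (1 + fderiv ℝ g w).det =
      ∑ i ∈ s, (1 + v i • fderiv ℝ g w).det * (Lagrange.basis s v i).eval 1 := fun w => by
    obtain ⟨p, hp, hpe⟩ := exists_polynomial_det_one_add_smul (fderiv ℝ g w)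
    have h1 := hpe 1
    rw [one_smul] at h1
    rw [← h1, Lagrange.eq_interpolate (f := p) hvinj, Lagrange.interpolate_apply,
      Polynomial.eval_finsetSum]
    · simp [hpe]
    · refine lt_of_le_of_lt Polynomial.degree_le_natDegree ?_
      simp only [s, Finset.card_range]
      exact_mod_cast Nat.lt_succ_of_le hp
  have hI : ∀ t : ℝ, IntegrableOn (fun w => (1 + t • fderiv ℝ g w).det) (ball 0 r) μ :=
      fun t => by
    have hc : Continuous (fun w => (1 + t • fderiv ℝ g w).det) := by
      have := hg.continuous_fderiv one_ne_zero
      exact ContinuousLinearMap.continuous_det.comp (by fun_prop)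
    exact (hc.continuousOn.integrableOn_compact (isCompact_closedBall 0 r)).mono_set
      ball_subset_closedBall
  simp_rw [hexp]
  rw [integral_finsetSum _ fun i _ => (hI (v i)).mul_const _]
  simp_rw [integral_mul_const, H _ (hv _)]
  rw [← Finset.mul_sum, ← Polynomial.eval_finsetSum, Lagrange.sum_basis hvinj ⟨0, by simp [s]⟩]
  simp

open MeasureTheory Metric in
/-- A `C¹` map that is the identity outside a ball has a zero. -/
theorem exists_zero_of_eq_self_off_ball {E : Type*} [NormedAddCommGroup E]
    [InnerProductSpace ℝ E] [FiniteDimensional ℝ E] {f : E → E} (hf : ContDiff ℝ 1 f) {r : ℝ}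
    (hr : 0 < r) (hid : ∀ w, r ≤ ‖w‖ → f w = w) : ∃ w, f w = 0 := by
  by_contra! hne
  let _ : MeasurableSpace E := borel E
  have _ : BorelSpace E := ⟨rfl⟩
  let μ : Measure E := Measure.addHaar
  obtain ⟨B, hB⟩ := (isCompact_closedBall (0 : E) r).exists_bound_of_continuousOn
    hf.continuous.continuousOn
  let R := max r B
  have hR : 0 < R := lt_max_of_lt_left hr
  have hfR : ∀ w, ‖w‖ ≤ R → ‖f w‖ ≤ R := fun w hw => by
    rcases le_total ‖w‖ r with h | h
    · exact (hB w (by simpa using h)).trans (le_max_right _ _)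
    · rw [hid w h]; exact hw
  have hfid : ∀ w, R ≤ ‖w‖ → f w = w := fun w hw => hid w ((le_max_left _ _).trans hw)
  let m : ℝ → ℝ := fun s => R + (s - R) * smoothTransition ((s - R) / R)
  have hm_le : ∀ s ≤ R, m s = R := fun s hs => by
    simp [m, smoothTransition.zero_of_nonpos
      (div_nonpos_of_nonpos_of_nonneg (sub_nonpos.2 hs) hR.le)]
  have hm_ge : ∀ s, 2 * R ≤ s → m s = s := fun s hs => by
    have : 1 ≤ (s - R) / R := by rw [le_div_iff₀ hR]; linarith
    simp [m, smoothTransition.one_of_one_le this]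
  have hm_mono : StrictMonoOn m (Set.Ici R) := fun s hs s' hs' hss' => by
    have hs : R ≤ s := hs
    have h1 : 0 < smoothTransition ((s' - R) / R) :=
      smoothTransition.pos_of_pos (div_pos (by linarith) hR)
    have h2 : smoothTransition ((s - R) / R) ≤ smoothTransition ((s' - R) / R) :=
      smoothTransition.monotone (by gcongr)
    have h3 := mul_le_mul_of_nonneg_left h2 (sub_nonneg.2 hs)
    have h4 := mul_lt_mul_of_pos_right (sub_lt_sub_right hss' R) h1
    simp only [m]
    linarith
  have hm_pos : ∀ s, 0 < m s := fun s => by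
    rcases le_total s R with h | h
    · rw [hm_le s h]; exact hR
    · have := mul_nonneg (sub_nonneg.2 h) (smoothTransition.nonneg ((s - R) / R))
      simp only [m]; linarith
  have hm_smooth : ContDiff ℝ 1 m := by
    have : ContDiff ℝ 1 fun s : ℝ => smoothTransition ((s - R) / R) :=
      smoothTransition.contDiff.comp (by fun_prop)
    fun_prop
  let F : E → E := fun w => (m ‖f w‖ / ‖f w‖) • f w
  have hFnorm : ∀ w, ‖F w‖ = m ‖f w‖ := fun w => by
    have := norm_pos_iff.2 (hne w)
    rw [norm_smul, Real.norm_of_nonneg (div_nonneg (hm_pos _).le this.le),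
      div_mul_cancel₀ _ this.ne']
  have hF : ContDiff ℝ 1 F := by
    have h1 : ContDiff ℝ 1 fun w => ‖f w‖ := hf.norm ℝ hne
    exact ((hm_smooth.comp h1).div h1 fun w => norm_ne_zero_iff.2 (hne w)).smul hf
  have hFid : ∀ w, 2 * R ≤ ‖w‖ → F w - w = 0 := fun w hw => by
    have h0 : ‖w‖ ≠ 0 := by linarith
    simp [F, hfid w (by linarith), hm_ge _ hw, h0]
  have hFd : ∀ w, HasFDerivAt F (fderiv ℝ F w) w :=
    fun w => (hF.differentiable one_ne_zero w).hasFDerivAt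
  have key := integral_det_one_add_fderiv μ (hF.sub contDiff_id) (r := 2 * R) hFid
  have hder : ∀ w, 1 + fderiv ℝ (fun w => F w - w) w = fderiv ℝ F w := fun w => by
    have := ((hFd w).sub (hasFDerivAt_id w)).fderiv
    have h2 : fderiv ℝ (fun w => F w - w) w = fderiv ℝ F w - ContinuousLinearMap.id ℝ E := this
    rw [h2]
    exact add_sub_cancel _ _
  have key' : ∫ w in ball (0 : E) (2 * R), (fderiv ℝ F w).det ∂μ =
      μ.real (ball (0 : E) (2 * R)) := by
    rw [← key]
    exact integral_congr_ae (.of_forall fun w => by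
      change _ = (1 + fderiv ℝ (fun w => F w - w) w).det
      rw [hder])
  have hzero : ∀ w ∈ ball (0 : E) R, (fderiv ℝ F w).det = 0 := fun w hw => by
    by_contra hdet
    have hconst : (fun w => inner ℝ (F w) (F w)) =ᶠ[nhds w] fun _ => R ^ 2 := by
      filter_upwards [isOpen_ball.mem_nhds hw] with a ha
      rw [real_inner_self_eq_norm_sq, hFnorm, hm_le _ (hfR a (mem_ball_zero_iff.1 ha).le)]
    have h1 : HasFDerivAt (fun w => inner ℝ (F w) (F w)) (0 : E →L[ℝ] ℝ) w :=
      (hasFDerivAt_const (R ^ 2) w).congr_of_eventuallyEq hconst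
    have h2 := h1.unique ((hFd w).inner ℝ (hFd w))
    obtain ⟨u, hu⟩ := (LinearMap.equivOfDetNeZero _ hdet).surjective (F w)
    have hu : fderiv ℝ F w u = F w := hu
    have h3 := congrArg (fun L : E →L[ℝ] ℝ => L u) h2
    simp [hu] at h3
    have := hFnorm w
    nlinarith [hm_pos ‖f w‖]
  let s := ball (0 : E) (2 * R) \ ball 0 R
  have hs : MeasurableSet s := measurableSet_ball.diff measurableSet_ball
  have hsub : ball (0 : E) R ⊆ ball 0 (2 * R) := ball_subset_ball (by linarith)
  have hmem : ∀ w ∈ s, R ≤ ‖w‖ ∧ ‖w‖ < 2 * R := fun w hw => by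
    simpa [s, and_comm] using hw
  have hinj : Set.InjOn F s := fun a ha b hb hab => by
    have ha' := hmem a ha
    have hb' := hmem b hb
    have h1 : ‖a‖ = ‖b‖ := by
      have := hFnorm a
      rw [hab, hFnorm b, hfid a ha'.1, hfid b hb'.1] at this
      exact (hm_mono.injOn hb'.1 ha'.1 this).symm
    have h2 : (m ‖b‖ / ‖b‖) • a = (m ‖b‖ / ‖b‖) • b := by
      simpa [F, hfid a ha'.1, hfid b hb'.1, h1] using hab
    exact smul_right_injective E (div_pos (hm_pos _) (by linarith)).ne' h2
  have himg : F '' s ⊆ s := by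
    rintro _ ⟨w, hw, rfl⟩
    have hw' := hmem w hw
    have h1 := hFnorm w
    rw [hfid w hw'.1] at h1
    have h2 := hm_mono.monotoneOn (Set.self_mem_Ici) hw'.1 hw'.1
    have h3 := hm_mono hw'.1 (show R ≤ 2 * R by linarith) hw'.2
    rw [hm_le R le_rfl] at h2
    rw [hm_ge _ le_rfl] at h3
    simp only [s, Set.mem_sdiff, mem_ball, dist_zero_right, h1, not_lt]
    exact ⟨h3, h2⟩
  have hcont : Continuous fun w => (fderiv ℝ F w).det :=
    ContinuousLinearMap.continuous_det.comp (hF.continuous_fderiv one_ne_zero)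
  have hI : IntegrableOn (fun w => (fderiv ℝ F w).det) (ball 0 (2 * R)) μ :=
    (hcont.continuousOn.integrableOn_compact (isCompact_closedBall 0 (2 * R))).mono_set
      ball_subset_closedBall
  have hsplit : ∫ w in ball (0 : E) (2 * R), (fderiv ℝ F w).det ∂μ =
      ∫ w in s, (fderiv ℝ F w).det ∂μ := by
    have := setIntegral_eq_zero_of_forall_eq_zero hzero (μ := μ)
    rw [setIntegral_sdiff measurableSet_ball hI hsub, this, sub_zero]
  have habs := integral_image_eq_integral_abs_det_fderiv_smul μ hs
    (fun w _ => (hFd w).hasFDerivWithinAt) hinj (fun _ => (1 : ℝ))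
  simp only [integral_const, smul_eq_mul, mul_one] at habs
  have hle : ∫ w in s, (fderiv ℝ F w).det ∂μ ≤ ∫ w in s, |(fderiv ℝ F w).det| ∂μ :=
    integral_mono (hI.mono_set Set.sdiff_subset) (hI.mono_set Set.sdiff_subset).abs
      fun w => le_abs_self _
  have hvol : μ.real (F '' s) ≤ μ.real s :=
    measureReal_mono himg ((measure_mono Set.sdiff_subset).trans_lt measure_ball_lt_top).ne
  have hdiff : μ.real s = μ.real (ball 0 (2 * R)) - μ.real (ball 0 R) :=
    measureReal_sdiff hsub measurableSet_ball
  have hpos : 0 < μ.real (ball (0 : E) R) :=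
    ENNReal.toReal_pos (measure_ball_pos μ 0 hR).ne' measure_ball_lt_top.ne
  simp only [measureReal_restrict_apply_univ] at habs
  rw [← habs] at hle
  linarith

/-- **Brouwer's theorem**, for maps at bounded distance from the identity: such a continuous map
has a zero. -/
theorem exists_zero_of_norm_sub_le {E : Type*} [NormedAddCommGroup E]
    [InnerProductSpace ℝ E] [FiniteDimensional ℝ E] {f : E → E} (hf : Continuous f) {R : ℝ}
    (hR : ∀ w, ‖f w - w‖ ≤ R) : ∃ w, f w = 0 := by
  by_contra! hne
  have hR0 : 0 ≤ R := (norm_nonneg _).trans (hR 0)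
  obtain ⟨g, hgs, hg, -⟩ := hf.exists_contDiff_approx 1 (ε := fun w => min 1 ‖f w‖) (by fun_prop)
    fun w => lt_min one_pos (norm_pos_iff.2 (hne w))
  have hg0 : ∀ w, g w ≠ 0 := fun w hw => by
    have := (hg w).trans_le (min_le_right _ _)
    rw [hw, dist_zero_left] at this
    exact this.false
  have hgR : ∀ w, ‖g w - w‖ < R + 1 := fun w => by
    have h1 := (hg w).trans_le (min_le_left _ _)
    rw [dist_eq_norm] at h1
    have h2 : g w - w = (g w - f w) + (f w - w) := by abel
    rw [h2]
    linarith [norm_add_le (g w - f w) (f w - w), hR w]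
  let φ : ContDiffBump (0 : E) := ⟨R + 1, R + 2, by linarith, by linarith⟩
  obtain ⟨w, hw⟩ := exists_zero_of_eq_self_off_ball (f := fun w => w + φ w • (g w - w))
    (contDiff_id.add (φ.contDiff.smul (hgs.sub contDiff_id))) (r := R + 2) (by linarith)
    fun w hw => by
      simp [φ.zero_of_le_dist (by simpa using hw)]
  rcases le_total ‖w‖ (R + 1) with h | h
  · rw [φ.one_of_mem_closedBall (by simpa using h), one_smul, add_sub_cancel] at hw
    exact hg0 w hw
  · have h1 : ‖w‖ = φ w * ‖g w - w‖ := by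
      rw [eq_neg_of_add_eq_zero_left hw, norm_neg, norm_smul, Real.norm_of_nonneg φ.nonneg,
        ← eq_neg_of_add_eq_zero_left hw]
    have h2 : φ w * ‖g w - w‖ ≤ 1 * ‖g w - w‖ := by gcongr; exact φ.le_one
    linarith [hgR w]

/-- A `C¹` function on `ℝ × ℝ^ι`, periodic in the first variable, which is at bounded distance from
the quadratic form with signs `σ` and whose gradient is asymptotically comparable to that of the
form. -/
structure IsTame {ι : Type*} [Fintype ι] [DecidableEq ι] (σ : ι → ℝ) (G : ℝ × (ι → ℝ) → ℝ)
    (G' : ℝ × (ι → ℝ) → (ℝ × (ι → ℝ) →L[ℝ] ℝ)) : Prop where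
  hasFDerivAt : ∀ p, HasFDerivAt G (G' p) p
  continuous_deriv : Continuous G'
  periodic : ∀ x v, G (x + 2 * π, v) = G (x, v)
  bounded : ∃ C, ∀ p, |G p - ∑ j, σ j * p.2 j ^ 2| ≤ C
  gradient : ∃ c > 0, ∃ C, (∀ p, |G' p (1, 0)| ≤ C) ∧
    ∀ p j, ∃ m ∈ Set.Icc c C, |G' p (0, Pi.single j 1) - m * (σ j * p.2 j)| ≤ C

/-- Truncation of a real number to `[-1, 1]`. -/
def truncOne (s : ℝ) : ℝ := max (-1) (min s 1)

theorem continuous_truncOne : Continuous truncOne := by unfold truncOne; fun_prop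

theorem abs_truncOne_le (s : ℝ) : |truncOne s| ≤ 1 :=
  abs_le.2 ⟨le_max_left _ _, max_le (by norm_num) (min_le_right _ _)⟩

theorem truncOne_of_one_le {s : ℝ} (hs : 1 ≤ s) : truncOne s = 1 := by
  simp [truncOne, hs]

theorem truncOne_of_le_neg_one {s : ℝ} (hs : s ≤ -1) : truncOne s = -1 := by
  simp [truncOne, hs]

theorem truncOne_mul_self_pos {s : ℝ} (hs : s ≠ 0) : 0 < truncOne s * s := by
  unfold truncOne
  rcases lt_or_gt_of_ne hs with h | h
  · exact mul_pos_of_neg_of_neg (max_lt (by norm_num) (min_lt_of_left_lt h)) h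
  · exact mul_pos (lt_max_of_lt_right (lt_min h one_pos)) h

theorem truncOne_mul_self_nonneg (s : ℝ) : 0 ≤ truncOne s * s := by
  rcases eq_or_ne s 0 with rfl | h
  · simp
  · exact (truncOne_mul_self_pos h).le

section Tame

variable {ι : Type*} [Fintype ι] [DecidableEq ι] {σ : ι → ℝ} {G : ℝ × (ι → ℝ) → ℝ}
  {G' : ℝ × (ι → ℝ) → (ℝ × (ι → ℝ) →L[ℝ] ℝ)}

theorem clm_apply_eq_sum (L : ℝ × (ι → ℝ) →L[ℝ] ℝ) (q : ℝ × (ι → ℝ)) :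
    L q = q.1 * L (1, 0) + ∑ j, q.2 j * L (0, Pi.single j 1) := by
  have h : q = q.1 • ((1, 0) : ℝ × (ι → ℝ)) +
      ∑ j, q.2 j • ((0, Pi.single j 1) : ℝ × (ι → ℝ)) := by
    refine Prod.ext ?_ ?_
    · simp [Prod.fst_sum]
    · ext i
      simp [Prod.snd_sum, Finset.sum_apply, Pi.single_apply]
  conv_lhs => rw [h]
  rw [map_add, map_smul, map_sum]
  simp only [map_smul, smul_eq_mul]

/-- The descent direction: the gradient with truncated coordinates. -/
def descentField (G' : ℝ × (ι → ℝ) → (ℝ × (ι → ℝ) →L[ℝ] ℝ)) (p : ℝ × (ι → ℝ)) : ℝ × (ι → ℝ) :=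
  (truncOne (G' p (1, 0)), fun j => truncOne (G' p (0, Pi.single j 1)))

theorem continuous_descentField (h : Continuous G') : Continuous (descentField G') := by
  refine Continuous.prodMk ?_ (continuous_pi fun j => ?_) <;>
  exact continuous_truncOne.comp (h.clm_apply continuous_const)

theorem descentField_self_pos {p : ℝ × (ι → ℝ)} (h : G' p ≠ 0) :
    0 < G' p (descentField G' p) := by
  rw [clm_apply_eq_sum]
  by_contra hle
  have h1 : ∀ j ∈ Finset.univ, 0 ≤ (descentField G' p).2 j * G' p (0, Pi.single j 1) :=
    fun j _ => truncOne_mul_self_nonneg _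
  have h2 : 0 ≤ (descentField G' p).1 * G' p (1, 0) := truncOne_mul_self_nonneg _
  have h3 := Finset.sum_nonneg h1
  have h4 : (descentField G' p).1 * G' p (1, 0) = 0 := by linarith
  have h5 := (Finset.sum_eq_zero_iff_of_nonneg h1).1 (by linarith)
  have h6 : G' p (1, 0) = 0 := by
    by_contra hne
    exact (truncOne_mul_self_pos hne).ne' h4
  have h7 : ∀ j, G' p (0, Pi.single j 1) = 0 := fun j => by
    by_contra hne
    exact (truncOne_mul_self_pos hne).ne' (h5 j (Finset.mem_univ j))
  refine h (ContinuousLinearMap.ext fun q => ?_)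
  rw [clm_apply_eq_sum]
  simp [h6, h7]

theorem IsTame.periodic_int (hG : IsTame σ G G') (k : ℤ) (p : ℝ × (ι → ℝ)) :
    G (p + (k * (2 * π), 0)) = G p := by
  have h : Function.Periodic (fun x => G (x, p.2)) (2 * π) := fun x => hG.periodic x p.2
  have := h.int_mul k p.1
  have e : p + ((k : ℝ) * (2 * π), 0) = (p.1 + k * (2 * π), p.2) := Prod.ext (by simp) (by simp)
  rw [e]
  exact this

theorem IsTame.deriv_periodic_int (hG : IsTame σ G G') (k : ℤ) (p : ℝ × (ι → ℝ)) :
    G' (p + (k * (2 * π), 0)) = G' p := by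
  have h1 : HasFDerivAt (fun q => G (q + (k * (2 * π), 0))) (G' (p + (k * (2 * π), 0))) p :=
    (hG.hasFDerivAt _).comp p ((hasFDerivAt_id p).add_const _)
  simp_rw [hG.periodic_int k] at h1
  exact h1.unique (hG.hasFDerivAt p)

/-- Far from the origin the descent direction is uniformly effective. -/
theorem IsTame.exists_far (hG : IsTame σ G G') (hσ : ∀ j, σ j = 1 ∨ σ j = -1) :
    ∃ R, ∀ p q : ℝ × (ι → ℝ), R < ‖p.2‖ → ‖q - p‖ ≤ 1 → 1 ≤ G' q (descentField G' p) := by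
  obtain ⟨c, hc, C, hx, hv⟩ := hG.gradient
  have hC : 0 ≤ C := (abs_nonneg _).trans (hx 0)
  set R₁ := 1 + (C + 1) / c with hR₁
  have hR₁1 : 1 ≤ R₁ := by rw [hR₁]; have : 0 ≤ (C + 1) / c := by positivity
                           linarith
  have hcR₁ : c * (R₁ - 1) = C + 1 := by rw [hR₁]; field_simp; ring
  set D := C * (R₁ + 2)
  have hD : C ≤ D := by simp only [D]; nlinarith
  set n := Fintype.card ι
  set R := R₁ + (C + (n + 1) * D + 1) / c with hR
  have hRR₁ : R₁ ≤ R := by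
    rw [hR]; have : 0 ≤ (C + (n + 1) * D + 1) / c := by positivity
    linarith
  have hcR : c * (R - 1) ≥ C + (n + 1) * D + 1 := by
    have : c * (R - 1) = c * (R₁ - 1) + (C + (n + 1) * D + 1) := by rw [hR]; field_simp; ring
    nlinarith
  have hlarge : ∀ (p q : ℝ × (ι → ℝ)) j, ‖q - p‖ ≤ 1 → R₁ ≤ |p.2 j| →
      c * (|p.2 j| - 1) - C ≤ (descentField G' p).2 j * G' q (0, Pi.single j 1) := by
    intro p q j hqp hj
    have hd : |q.2 j - p.2 j| ≤ 1 := by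
      have h1 := norm_le_pi_norm (q - p).2 j
      exact (h1.trans (norm_snd_le _)).trans hqp
    obtain ⟨m, hm, hm'⟩ := hv p j
    obtain ⟨l, hl, hl'⟩ := hv q j
    have hσ' : |σ j * p.2 j| = |p.2 j| := by
      rcases hσ j with h | h <;> simp [h]
    have hσd : |σ j * q.2 j - σ j * p.2 j| ≤ 1 := by
      rw [← mul_sub, abs_mul]; rcases hσ j with h | h <;> simpa [h] using hd
    rw [← hσ'] at hj ⊢
    generalize σ j * p.2 j = s at *
    generalize σ j * q.2 j = r at *
    have e1 := abs_le.1 hm'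
    have e2 := abs_le.1 hl'
    have e3 := abs_le.1 hσd
    change _ ≤ truncOne _ * _
    rcases le_total 0 s with hs | hs
    · rw [abs_of_nonneg hs] at hj ⊢
      have h2 : c * s ≤ m * s := mul_le_mul_of_nonneg_right hm.1 hs
      have h3 : c * (R₁ - 1) ≤ c * (s - 1) := by gcongr
      rw [truncOne_of_one_le (by nlinarith), one_mul]
      have h4 : c * (s - 1) ≤ l * r :=
        mul_le_mul hl.1 (by linarith) (by linarith) (by linarith [hl.1])
      linarith
    · rw [abs_of_nonpos hs] at hj ⊢
      have h2 : c * (-s) ≤ m * (-s) := mul_le_mul_of_nonneg_right hm.1 (by linarith)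
      have h3 : c * (R₁ - 1) ≤ c * (-s - 1) := by gcongr
      rw [truncOne_of_le_neg_one (by nlinarith)]
      have h4 : c * (-s - 1) ≤ l * (-r) :=
        mul_le_mul hl.1 (by linarith) (by linarith) (by linarith [hl.1])
      linarith
  have hall : ∀ (p q : ℝ × (ι → ℝ)) j, ‖q - p‖ ≤ 1 →
      -D ≤ (descentField G' p).2 j * G' q (0, Pi.single j 1) := by
    intro p q j hqp
    rcases le_total R₁ |p.2 j| with hj | hj
    · have h1 := hlarge p q j hqp hj
      have h3 : c * (R₁ - 1) ≤ c * (|p.2 j| - 1) := by gcongr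
      linarith
    · have hd : |q.2 j - p.2 j| ≤ 1 := by
        have h1 := norm_le_pi_norm (q - p).2 j
        exact (h1.trans (norm_snd_le _)).trans hqp
      obtain ⟨l, hl, hl'⟩ := hv q j
      have hq : |q.2 j| ≤ R₁ + 1 := by
        have := abs_sub_abs_le_abs_sub (q.2 j) (p.2 j)
        linarith
      have hσ' : |σ j * q.2 j| = |q.2 j| := by
        rcases hσ j with h | h <;> simp [h]
      have h1 : |G' q (0, Pi.single j 1)| ≤ D := by
        have h2 : |l * (σ j * q.2 j)| ≤ C * (R₁ + 1) := by
          rw [abs_mul, hσ', abs_of_nonneg (hc.le.trans hl.1)]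
          exact mul_le_mul hl.2 hq (abs_nonneg _) hC
        have h3 := abs_sub_abs_le_abs_sub (G' q (0, Pi.single j 1)) (l * (σ j * q.2 j))
        simp only [D]; linarith
      have h4 : |(descentField G' p).2 j * G' q (0, Pi.single j 1)| ≤ 1 * D := by
        rw [abs_mul]
        exact mul_le_mul (abs_truncOne_le _) h1 (abs_nonneg _) zero_le_one
      linarith [(abs_le.1 h4).1]
  refine ⟨R, fun p q hp hqp => ?_⟩
  have hj : ∃ j, R < |p.2 j| := by
    by_contra! hcon
    exact hp.not_ge ((pi_norm_le_iff_of_nonneg (by linarith)).2 hcon)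
  obtain ⟨j, hj⟩ := hj
  rw [clm_apply_eq_sum]
  have h1 : |(descentField G' p).1 * G' q (1, 0)| ≤ 1 * C := by
    rw [abs_mul]
    exact mul_le_mul (abs_truncOne_le _) (hx q) (abs_nonneg _) zero_le_one
  have h2 := Finset.single_le_sum
    (f := fun i => (descentField G' p).2 i * G' q (0, Pi.single i 1) + D)
    (fun i _ => by linarith [hall p q i hqp]) (Finset.mem_univ j)
  rw [Finset.sum_add_distrib, Finset.sum_const, nsmul_eq_mul, Finset.card_univ] at h2
  have h3 := hlarge p q j hqp (hRR₁.trans hj.le)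
  have h4 : c * (R - 1) ≤ c * (|p.2 j| - 1) := by gcongr
  have h5 := (abs_le.1 h1).1
  have h6 : (descentField G' p).2 j * G' q (0, Pi.single j 1) + D ≤
    ∑ i, (descentField G' p).2 i * G' q (0, Pi.single i 1) + n * D := h2
  nlinarith

/-- Away from critical points, the descent direction is uniformly effective on a slab of values. -/
theorem IsTame.exists_uniform_descent (hG : IsTame σ G G') (hσ : ∀ j, σ j = 1 ∨ σ j = -1)
    {a b : ℝ} (hcrit : ∀ p, G p ∈ Set.Icc a b → G' p ≠ 0) :
    ∃ τ > 0, ∃ η > 0, ∀ p, G p ∈ Set.Icc a b → ∀ q, ‖q - p‖ ≤ τ →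
      η ≤ G' q (descentField G' p) := by
  obtain ⟨R, hR⟩ := hG.exists_far hσ
  have hGc : Continuous G := continuous_iff_continuousAt.2 fun p => (hG.hasFDerivAt p).continuousAt
  let K : Set (ℝ × (ι → ℝ)) :=
    (Set.Icc 0 (2 * π) ×ˢ Metric.closedBall 0 R) ∩ G ⁻¹' Set.Icc a b
  have hK : IsCompact K :=
    (isCompact_Icc.prod (isCompact_closedBall _ _)).inter_right (isClosed_Icc.preimage hGc)
  let Ψ : (ℝ × (ι → ℝ)) × (ℝ × (ι → ℝ)) → ℝ := fun x => G' (x.1 + x.2) (descentField G' x.1)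
  have hΨ : Continuous Ψ :=
    (hG.continuous_deriv.comp (continuous_fst.add continuous_snd)).clm_apply
      ((continuous_descentField hG.continuous_deriv).comp continuous_fst)
  have hsub : K ×ˢ ({0} : Set (ℝ × (ι → ℝ))) ⊆ Ψ ⁻¹' Set.Ioi 0 := by
    rintro ⟨p, d⟩ ⟨hp, hd⟩
    obtain rfl : d = 0 := hd
    simpa [Ψ] using descentField_self_pos (hcrit p hp.2)
  obtain ⟨U, V, -, hV, hKU, h0V, hUV⟩ := generalized_tube_lemma hK isCompact_singleton
    (isOpen_Ioi.preimage hΨ) hsub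
  obtain ⟨τ, hτ, hτV⟩ := Metric.nhds_basis_closedBall.mem_iff.1 (hV.mem_nhds (h0V rfl))
  obtain ⟨η, hη, hη'⟩ := (hK.prod (isCompact_closedBall (0 : ℝ × (ι → ℝ)) τ)).exists_forall_le'
    hΨ.continuousOn (a := 0) fun x hx => hUV ⟨hKU hx.1, hτV hx.2⟩
  refine ⟨min τ 1, by positivity, min η 1, by positivity, fun p hp q hq => ?_⟩
  rcases lt_or_ge R ‖p.2‖ with h | h
  · exact (min_le_right _ _).trans (hR p q h (hq.trans (min_le_right _ _)))
  · obtain ⟨k, hk, -⟩ := existsUnique_add_zsmul_mem_Ico Real.two_pi_pos p.1 0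
    have hk' : p.1 + k * (2 * π) ∈ Set.Ico 0 (2 * π) := by simpa using hk
    have h1 := hη' (p + (k * (2 * π), 0), q - p) ⟨⟨⟨⟨?_, ?_⟩, ?_⟩, ?_⟩, ?_⟩
    · have h2 : p + (k * (2 * π), 0) + (q - p) = q + ((k : ℝ) * (2 * π), 0) := by abel
      simp only [Ψ, h2, hG.deriv_periodic_int, descentField] at h1
      exact (min_le_left _ _).trans h1
    · exact hk'.1
    · exact hk'.2.le
    · simpa using h
    · simpa [hG.periodic_int] using hp
    · simpa using hq.trans (min_le_left _ _)

theorem IsTame.sub_smul_le (hG : IsTame σ G G') {p V : ℝ × (ι → ℝ)} {τ η : ℝ}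
    (hV : ‖V‖ ≤ 1) (h : ∀ q, ‖q - p‖ ≤ τ → η ≤ G' q V) {t : ℝ} (ht : t ∈ Set.Icc 0 τ) :
    G (p - t • V) ≤ G p - η * t := by
  have hd : ∀ s, HasDerivAt (fun s : ℝ => G (p - s • V)) (-(G' (p - s • V) V)) s := fun s => by
    have h1 : HasDerivAt (fun s : ℝ => p - s • V) (-V) s := by
      simpa using ((hasDerivAt_id s).smul_const V).const_sub p
    have := (hG.hasFDerivAt (p - s • V)).comp_hasDerivAt s h1
    rw [map_neg] at this
    exact this
  have := Convex.image_sub_le_mul_sub_of_deriv_le (convex_Icc 0 τ) (C := -η)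
    (f := fun s : ℝ => G (p - s • V)) (fun s _ => (hd s).continuousAt.continuousWithinAt)
    (fun s _ => (hd s).differentiableAt.differentiableWithinAt) (fun s hs => ?_) 0
    ⟨le_rfl, ht.1.trans ht.2⟩ t ht ht.1
  · simp at this
    linarith
  · rw [(hd s).deriv]
    have hs := interior_subset hs
    have := h (p - s • V) (by
      rw [sub_sub_cancel_left, norm_neg, norm_smul, Real.norm_of_nonneg hs.1]
      nlinarith [hs.1, hs.2, norm_nonneg V])
    linarith

theorem norm_descentField_le (p : ℝ × (ι → ℝ)) : ‖descentField G' p‖ ≤ 1 := by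
  rw [norm_prod_le_iff]
  exact ⟨abs_truncOne_le _,
    (pi_norm_le_iff_of_nonneg zero_le_one).2 fun j => abs_truncOne_le _⟩

/-- Continuous families of points, parametrised by the negative space of the quadratic form and
at bounded distance from the tautological one. -/
def IsAdmissible (σ : ι → ℝ) (h : (ι → ℝ) → ℝ × (ι → ℝ)) : Prop :=
  Continuous h ∧ ∃ R, ∀ w j, σ j = -1 → |(h w).2 j - w j| ≤ R

/-- An admissible family can be pushed down through a slab without critical values. -/
theorem IsTame.exists_pushed_down (hG : IsTame σ G G') (hσ : ∀ j, σ j = 1 ∨ σ j = -1)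
    {a b a' : ℝ} (hab : a < b) (ha' : a < a') (hcrit : ∀ p, G p ∈ Set.Icc a b → G' p ≠ 0)
    {h : (ι → ℝ) → ℝ × (ι → ℝ)} (hh : IsAdmissible σ h) (hb : ∀ w, G (h w) ≤ b) :
    ∃ h', IsAdmissible σ h' ∧ ∀ w, G (h' w) ≤ a' := by
  obtain ⟨τ, hτ, η, hη, H⟩ := hG.exists_uniform_descent hσ hcrit
  have hGc : Continuous G := continuous_iff_continuousAt.2 fun p => (hG.hasFDerivAt p).continuousAt
  have hba : 0 < b - a := sub_pos.2 hab
  set θ := min (η * τ / (b - a)) (1 / 2)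
  have hθ : 0 < θ := by positivity
  have hθ1 : θ ≤ 1 / 2 := min_le_right _ _
  have hstep : ∀ k : ℕ, ∃ h', IsAdmissible σ h' ∧ ∀ w, G (h' w) ≤ a + (1 - θ) ^ k * (b - a) := by
    intro k
    induction k with
    | zero => exact ⟨h, hh, by simpa using hb⟩
    | succ k ih =>
      obtain ⟨f, ⟨hfc, R, hfR⟩, hf⟩ := ih
      have hpow1 : (1 - θ) ^ k ≤ 1 := pow_le_one₀ (by linarith) (by linarith)
      have hpow0 : 0 < (1 - θ) ^ k := pow_pos (by linarith) k
      have hfb : ∀ w, G (f w) ≤ b := fun w => (hf w).trans (by nlinarith)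
      let χ : ℝ × (ι → ℝ) → ℝ := fun p => max 0 ((G p - a) / (b - a))
      have hχ0 : ∀ p, 0 ≤ χ p := fun p => le_max_left _ _
      have hχ1 : ∀ w, χ (f w) ≤ 1 := fun w =>
        max_le zero_le_one ((div_le_one hba).2 (by linarith [hfb w]))
      have hχc : Continuous χ := by fun_prop
      refine ⟨fun w => f w - (τ * χ (f w)) • descentField G' (f w), ⟨?_, R + τ, ?_⟩, ?_⟩
      · have := continuous_descentField hG.continuous_deriv
        fun_prop
      · intro w j hj
        have h1 := hfR w j hj
        have h2 : |τ * χ (f w) * (descentField G' (f w)).2 j| ≤ τ := by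
          rw [abs_mul, abs_of_nonneg (mul_nonneg hτ.le (hχ0 _))]
          have h3 : |(descentField G' (f w)).2 j| ≤ 1 := abs_truncOne_le _
          have h4 : τ * χ (f w) ≤ τ := by nlinarith [hχ1 w]
          nlinarith [abs_nonneg ((descentField G' (f w)).2 j), mul_nonneg hτ.le (hχ0 (f w))]
        have h5 : (f w - (τ * χ (f w)) • descentField G' (f w)).2 j - w j =
            ((f w).2 j - w j) - τ * χ (f w) * (descentField G' (f w)).2 j := by
          simp; ring
        rw [h5]
        exact (abs_sub _ _).trans (add_le_add h1 h2)
      · intro w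
        have hbound : 0 ≤ (1 - θ) ^ (k + 1) * (b - a) :=
          mul_nonneg (pow_nonneg (by linarith) _) hba.le
        rcases le_total (G (f w)) a with hle | hge
        · have : χ (f w) = 0 :=
            max_eq_left (div_nonpos_of_nonpos_of_nonneg (by linarith) hba.le)
          simp only [this, mul_zero, zero_smul, sub_zero]
          linarith
        · have h1 := hG.sub_smul_le (norm_descentField_le (f w)) (H (f w) ⟨hge, hfb w⟩)
            (t := τ * χ (f w)) ⟨mul_nonneg hτ.le (hχ0 _), by nlinarith [hχ1 w]⟩
          have h2 : χ (f w) = (G (f w) - a) / (b - a) :=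
            max_eq_right (div_nonneg (by linarith) hba.le)
          have h3 : θ * (G (f w) - a) ≤ η * (τ * χ (f w)) := by
            rw [h2]
            calc θ * (G (f w) - a) ≤ η * τ / (b - a) * (G (f w) - a) :=
                  mul_le_mul_of_nonneg_right (min_le_left _ _) (by linarith)
              _ = _ := by ring
          have h4 := hf w
          have h5 : (1 - θ) * (G (f w) - a) ≤ (1 - θ) * ((1 - θ) ^ k * (b - a)) :=
            mul_le_mul_of_nonneg_left (by linarith) (by linarith)
          have h6 : (1 - θ) ^ (k + 1) * (b - a) = (1 - θ) * ((1 - θ) ^ k * (b - a)) := by ring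
          rw [h6]
          linarith
  obtain ⟨k, hk⟩ := exists_pow_lt_of_lt_one (div_pos (sub_pos.2 ha') hba)
    (show 1 - θ < 1 by linarith)
  obtain ⟨h', hh', hk'⟩ := hstep k
  refine ⟨h', hh', fun w => (hk' w).trans ?_⟩
  rw [lt_div_iff₀ hba] at hk
  linarith

end Tame

/-- An admissible family meets the set where the quadratic form is nonnegative. -/
theorem IsAdmissible.exists_nonneg {ι : Type*} [Fintype ι] {σ : ι → ℝ}
    (hσ : ∀ j, σ j = 1 ∨ σ j = -1) {h : (ι → ℝ) → ℝ × (ι → ℝ)} (hh : IsAdmissible σ h) :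
    ∃ w, 0 ≤ ∑ j, σ j * (h w).2 j ^ 2 := by
  classical
  obtain ⟨hc, R, hR⟩ := hh
  let f : EuclideanSpace ℝ ι → EuclideanSpace ℝ ι := fun w =>
    WithLp.toLp 2 fun j => if σ j = -1 then (h w.ofLp).2 j else w j
  have hf : Continuous f := by
    refine (PiLp.continuous_toLp 2 _).comp (continuous_pi fun j => ?_)
    have h1 : Continuous fun w : EuclideanSpace ℝ ι => (h w.ofLp).2 j :=
      (continuous_apply j).comp (continuous_snd.comp (hc.comp (PiLp.continuous_ofLp 2 _)))
    split_ifs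
    · exact h1
    · fun_prop
  obtain ⟨w, hw⟩ := exists_zero_of_norm_sub_le hf (R := √(∑ _j : ι, R ^ 2)) fun w => by
    rw [EuclideanSpace.norm_eq]
    refine Real.sqrt_le_sqrt (Finset.sum_le_sum fun j _ => ?_)
    simp only [f, PiLp.sub_apply]
    split_ifs with hj
    · have := hR w.ofLp j hj
      rw [Real.norm_eq_abs]
      gcongr
    · simp; positivity
  refine ⟨w.ofLp, Finset.sum_nonneg fun j _ => ?_⟩
  rcases hσ j with hj | hj
  · rw [hj, one_mul]; positivity
  · have : f w j = 0 := by rw [hw]; rfl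
    simp only [f, hj, if_true] at this
    simp [this]

section Extension

open scoped InnerProductSpace

variable {E : Type*} [NormedAddCommGroup E] [InnerProductSpace ℝ E]

/-- A function with a quadratic first-order Taylor estimate has a Lipschitz gradient. -/
theorem norm_gradient_sub_le {S : E → ℝ} {b : E → E} {K : ℝ}
    (h : ∀ x y, |S (x + y) - S x - ⟪b x, y⟫_ℝ| ≤ K * ‖y‖ ^ 2) (x y : E) :
    ‖b x - b y‖ ≤ 6 * K * ‖x - y‖ := by
  rcases eq_or_ne (b x - b y) 0 with h0 | h0
  · rw [h0, norm_zero]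
    rcases eq_or_ne x y with rfl | hxy
    · simp
    have h1 := (abs_nonneg _).trans (h x (x - y))
    have h2 : 0 < ‖x - y‖ := norm_pos_iff.2 (sub_ne_zero.2 hxy)
    have : 0 ≤ K := nonneg_of_mul_nonneg_left h1 (by positivity)
    positivity
  rcases eq_or_ne x y with rfl | hxy
  · simp
  have hd : 0 < ‖x - y‖ := norm_pos_iff.2 (sub_ne_zero.2 hxy)
  have hD : 0 < ‖b x - b y‖ := norm_pos_iff.2 h0
  set d := x - y
  set D := b x - b y
  have hK : 0 ≤ K := nonneg_of_mul_nonneg_left ((abs_nonneg _).trans (h x d)) (by positivity)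
  set k := (‖d‖ / ‖D‖) • D with hk
  have hkn : ‖k‖ = ‖d‖ := by
    rw [hk, norm_smul, Real.norm_of_nonneg (by positivity)]; field_simp
  have h1 := abs_le.1 (h x k)
  have h2 := abs_le.1 (h y (d + k))
  have h3 := abs_le.1 (h y d)
  have hyd : y + d = x := by simp [d]
  rw [← add_assoc, hyd] at h2
  rw [hyd] at h3
  rw [hkn] at h1
  have h4 : ‖d + k‖ ^ 2 ≤ (2 * ‖d‖) ^ 2 := by
    gcongr
    calc _ ≤ ‖d‖ + ‖k‖ := norm_add_le _ _
      _ = _ := by rw [hkn]; ring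
  have h5 : ⟪D, k⟫_ℝ = ‖d‖ * ‖D‖ := by
    rw [hk, real_inner_smul_right, real_inner_self_eq_norm_sq]; field_simp
  have h6 : ⟪D, k⟫_ℝ = ⟪b x, k⟫_ℝ - ⟪b y, k⟫_ℝ := inner_sub_left _ _ _
  rw [inner_add_right] at h2
  have h7 : ‖d‖ * ‖D‖ ≤ ‖d‖ * (6 * K * ‖d‖) := by
    have := mul_le_mul_of_nonneg_left h4 hK
    nlinarith
  exact le_of_mul_le_mul_left h7 hd

theorem continuous_of_taylor {S : E → ℝ} {b : E → E} {K : ℝ}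
    (h : ∀ x y, |S (x + y) - S x - ⟪b x, y⟫_ℝ| ≤ K * ‖y‖ ^ 2) : Continuous b :=
  (LipschitzWith.of_dist_le' fun x y => by
    simpa [dist_eq_norm] using norm_gradient_sub_le h x y).continuous

theorem hasFDerivAt_of_taylor {S : E → ℝ} {b : E → E} {K : ℝ}
    (h : ∀ x y, |S (x + y) - S x - ⟪b x, y⟫_ℝ| ≤ K * ‖y‖ ^ 2) (x : E) :
    HasFDerivAt S (innerSL ℝ (b x)) x := by
  rw [hasFDerivAt_iff_isLittleO_nhds_zero]
  refine Asymptotics.IsBigO.trans_isLittleO (g := fun y : E => ‖y‖ ^ 2)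
    (Asymptotics.IsBigO.of_bound K (Filter.Eventually.of_forall fun y => ?_))
    (Asymptotics.isLittleO_norm_pow_id one_lt_two)
  simpa using h x y

/-- The quadratic majorants in the sup-inf formula for a `C^{1,1}` extension. -/
noncomputable def jetMajorant (M : ℝ) (P : E) (f : ℝ) (g w : E) : ℝ :=
  f + 1 / 2 * ⟪g, w - P⟫_ℝ + M / 4 * ‖w - P‖ ^ 2 - ‖g‖ ^ 2 / (4 * M)

variable {ι : Type*} {P : ι → E} {f : ι → ℝ} {g : ι → E} {M : ℝ}

theorem continuous_jetMajorant (M : ℝ) (P : E) (f : ℝ) (g : E) :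
    Continuous (jetMajorant M P f g) := by
  unfold jetMajorant; fun_prop

theorem sub_le_jetMajorant (hM : 0 < M) (P : E) (f : ℝ) (g w : E) :
    f - ‖g‖ ^ 2 / (2 * M) ≤ jetMajorant M P f g w := by
  have h : 0 ≤ ‖(1 / (2 * M)) • g + (1 / 2 : ℝ) • (w - P)‖ ^ 2 := by positivity
  rw [norm_add_sq_real, norm_smul, norm_smul, real_inner_smul_left, real_inner_smul_right,
    Real.norm_of_nonneg (by positivity), Real.norm_of_nonneg (by positivity)] at h
  have h2 := mul_nonneg hM.le h
  unfold jetMajorant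
  have : M * ((1 / (2 * M) * ‖g‖) ^ 2 + 2 * (1 / (2 * M) * (1 / 2 * ⟪g, w - P⟫_ℝ)) +
      (1 / 2 * ‖w - P‖) ^ 2) =
    ‖g‖ ^ 2 / (4 * M) + 1 / 2 * ⟪g, w - P⟫_ℝ + M / 4 * ‖w - P‖ ^ 2 := by field_simp; ring
  rw [this] at h2
  have : ‖g‖ ^ 2 / (2 * M) = ‖g‖ ^ 2 / (4 * M) + ‖g‖ ^ 2 / (4 * M) := by field_simp; ring
  linarith

theorem jetMajorant_sub (hM : 0 < M) (P : E) (f : ℝ) (g w : E) :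
    jetMajorant M P f g w - M / 2 * ‖P - w‖ ^ 2 = f - M / 4 * ‖w - (P + M⁻¹ • g)‖ ^ 2 := by
  have h : w - (P + M⁻¹ • g) = (w - P) - M⁻¹ • g := by abel
  rw [h, norm_sub_rev P w, norm_sub_sq_real (w - P), norm_smul, real_inner_smul_right,
    Real.norm_of_nonneg (by positivity), real_inner_comm]
  unfold jetMajorant
  field_simp
  ring

/-- The midpoint form of strong concavity. -/
theorem jetMajorant_midpoint (P : E) (f : ℝ) (g x w w' : E) :
    jetMajorant M P f g ((1 / 2 : ℝ) • (w + w')) - M / 2 * ‖x - (1 / 2 : ℝ) • (w + w')‖ ^ 2 =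
      1 / 2 * (jetMajorant M P f g w - M / 2 * ‖x - w‖ ^ 2) +
      1 / 2 * (jetMajorant M P f g w' - M / 2 * ‖x - w'‖ ^ 2) + M / 16 * ‖w - w'‖ ^ 2 := by
  unfold jetMajorant
  simp only [← real_inner_self_eq_norm_sq, inner_sub_left, inner_sub_right, inner_add_left,
    inner_add_right, real_inner_smul_left, real_inner_smul_right]
  rw [real_inner_comm w w', real_inner_comm w P, real_inner_comm w' P, real_inner_comm w x,
    real_inner_comm w' x]
  ring

theorem jetMajorant_touch {C : ℝ} (hC : 0 < C) {P Q g g' : E} {f f' : ℝ}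
    (hf : |f - f' - ⟪g', P - Q⟫_ℝ| ≤ C * ‖P - Q‖ ^ 2) (hg : ‖g - g'‖ ≤ C * ‖P - Q‖) :
    f ≤ jetMajorant (8 * C) Q f' g' (P + (8 * C)⁻¹ • g) -
      8 * C / 2 * ‖P - (P + (8 * C)⁻¹ • g)‖ ^ 2 := by
  have h : P + (8 * C)⁻¹ • g - Q = (P - Q) + (8 * C)⁻¹ • g := by abel
  have h1 : |⟪g - g', P - Q⟫_ℝ| ≤ C * ‖P - Q‖ ^ 2 :=
    (abs_real_inner_le_norm _ _).trans (by nlinarith [norm_nonneg (P - Q)])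
  have h2 : ‖g - g'‖ ^ 2 ≤ (C * ‖P - Q‖) ^ 2 := by gcongr
  unfold jetMajorant
  rw [h, sub_add_cancel_left, norm_neg, norm_smul, norm_add_sq_real, inner_add_right, norm_smul,
    Real.norm_of_nonneg (by positivity), real_inner_smul_right, real_inner_smul_right]
  rw [norm_sub_sq_real] at h2
  rw [inner_sub_left] at h1
  have h3 := (abs_le.1 hf).2
  have h4 := (abs_le.1 h1).1
  rw [real_inner_comm g (P - Q), real_inner_comm g g']
  have h5 : f' + 1 / 2 * (⟪g', P - Q⟫_ℝ + (8 * C)⁻¹ * ⟪g, g'⟫_ℝ) +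
      8 * C / 4 * (‖P - Q‖ ^ 2 + 2 * ((8 * C)⁻¹ * ⟪g, P - Q⟫_ℝ) + ((8 * C)⁻¹ * ‖g‖) ^ 2) -
      ‖g'‖ ^ 2 / (4 * (8 * C)) - 8 * C / 2 * ((8 * C)⁻¹ * ‖g‖) ^ 2 =
      f' + 1 / 2 * (⟪g', P - Q⟫_ℝ + ⟪g, P - Q⟫_ℝ) + 2 * C * ‖P - Q‖ ^ 2 -
      (‖g‖ ^ 2 - 2 * ⟪g, g'⟫_ℝ + ‖g'‖ ^ 2) / (32 * C) := by
    field_simp; ring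
  have h6 : (‖g‖ ^ 2 - 2 * ⟪g, g'⟫_ℝ + ‖g'‖ ^ 2) / (32 * C) ≤ C * ‖P - Q‖ ^ 2 / 32 := by
    rw [div_le_iff₀ (by positivity)]
    nlinarith
  have h7 : 0 ≤ C * ‖P - Q‖ ^ 2 := by positivity
  rw [h5]
  linarith

/-- The lower envelope of the quadratic majorants. -/
noncomputable def jetEnvelope (M : ℝ) (P : ι → E) (f : ι → ℝ) (g : ι → E) (w : E) : ℝ :=
  ⨅ i, jetMajorant M (P i) (f i) (g i) w

theorem bddBelow_jetMajorant (hM : 0 < M) {A : ℝ} (hf : ∀ i, |f i| ≤ A) (hg : ∀ i, ‖g i‖ ≤ A)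
    (w : E) : BddBelow (Set.range fun i => jetMajorant M (P i) (f i) (g i) w) := by
  refine ⟨-A - A ^ 2 / (2 * M), ?_⟩
  rintro _ ⟨i, rfl⟩
  refine le_trans ?_ (sub_le_jetMajorant hM _ _ _ _)
  have h1 := (abs_le.1 (hf i)).1
  have h2 := hg i
  have : ‖g i‖ ^ 2 / (2 * M) ≤ A ^ 2 / (2 * M) := by gcongr
  linarith

variable [Nonempty ι]

/-- Strong concavity of the regularised envelope, in midpoint form. -/
theorem jetEnvelope_midpoint
    (hb : ∀ w, BddBelow (Set.range fun i => jetMajorant M (P i) (f i) (g i) w))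
    (x w w' : E) :
    1 / 2 * (jetEnvelope M P f g w - M / 2 * ‖x - w‖ ^ 2) +
      1 / 2 * (jetEnvelope M P f g w' - M / 2 * ‖x - w'‖ ^ 2) + M / 16 * ‖w - w'‖ ^ 2 ≤
    jetEnvelope M P f g ((1 / 2 : ℝ) • (w + w')) - M / 2 * ‖x - (1 / 2 : ℝ) • (w + w')‖ ^ 2 := by
  rw [le_sub_iff_add_le]
  refine le_ciInf fun i => ?_
  have h1 : jetEnvelope M P f g w ≤ _ := ciInf_le (hb w) i
  have h2 : jetEnvelope M P f g w' ≤ _ := ciInf_le (hb w') i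
  have h3 := jetMajorant_midpoint (M := M) (P i) (f i) (g i) x w w'
  linarith

theorem exists_forall_jetEnvelope_le [FiniteDimensional ℝ E] (hM : 0 < M)
    (hb : ∀ w, BddBelow (Set.range fun i => jetMajorant M (P i) (f i) (g i) w)) (x : E) :
    ∃ w₀, ∀ w, jetEnvelope M P f g w - M / 2 * ‖x - w‖ ^ 2 ≤
      jetEnvelope M P f g w₀ - M / 2 * ‖x - w₀‖ ^ 2 - M / 8 * ‖w - w₀‖ ^ 2 := by
  have := FiniteDimensional.proper ℝ E
  set θ : E → ℝ := fun w => jetEnvelope M P f g w - M / 2 * ‖x - w‖ ^ 2 with hθ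
  suffices h : ∃ w₀, ∀ w, θ w ≤ θ w₀ by
    obtain ⟨w₀, hw₀⟩ := h
    refine ⟨w₀, fun w => ?_⟩
    have h1 := jetEnvelope_midpoint hb x w w₀
    have h2 := hw₀ ((1 / 2 : ℝ) • (w + w₀))
    simp only [hθ] at h2
    linarith
  have husc : UpperSemicontinuous θ := by
    have h1 : UpperSemicontinuous fun w => ⨅ i, jetMajorant M (P i) (f i) (g i) w :=
      upperSemicontinuous_ciInf hb fun i => (continuous_jetMajorant _ _ _ _).upperSemicontinuous
    have h2 : Continuous fun w => -(M / 2 * ‖x - w‖ ^ 2) := by fun_prop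
    exact h1.add h2.upperSemicontinuous
  obtain ⟨i⟩ := ‹Nonempty ι›
  set q := jetMajorant M (P i) (f i) (g i) x
  set L := (1 / 2 : ℝ) • g i + (M / 2) • (x - P i) with hL
  have hle : ∀ w, θ w ≤ q + ‖L‖ * ‖w - x‖ - M / 4 * ‖w - x‖ ^ 2 := by
    intro w
    have h1 : jetEnvelope M P f g w ≤ _ := ciInf_le (hb w) i
    have h2 : jetMajorant M (P i) (f i) (g i) w - M / 2 * ‖x - w‖ ^ 2 =
        q + ⟪L, w - x⟫_ℝ - M / 4 * ‖w - x‖ ^ 2 := by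
      have e : w - P i = (w - x) + (x - P i) := by abel
      simp only [jetMajorant, q, hL]
      rw [e, norm_add_sq_real, norm_sub_rev x w, inner_add_right, inner_add_left,
        real_inner_smul_left, real_inner_smul_left, real_inner_comm (w - x) (x - P i)]
      ring
    have h3 := real_inner_le_norm L (w - x)
    simp only [hθ]
    linarith
  set R := 4 / M * (‖L‖ + |q - θ x| + 1) + 1
  have hR : 1 ≤ R := le_add_of_nonneg_left (by positivity)
  obtain ⟨w₀, -, hw₀⟩ := (husc.upperSemicontinuousOn (Metric.closedBall x R)).exists_isMaxOn
    ⟨x, Metric.mem_closedBall_self (by linarith)⟩ (isCompact_closedBall x R)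
  refine ⟨w₀, fun w => ?_⟩
  rcases le_or_gt ‖w - x‖ R with h | h
  · exact hw₀ (mem_closedBall_iff_norm.2 h)
  · refine le_trans ?_ (hw₀ (Metric.mem_closedBall_self (by linarith)))
    have h1 := hle w
    have h2 : ‖L‖ + |q - θ x| + 1 ≤ M / 4 * ‖w - x‖ := by
      have h3 : M / 4 * R ≤ M / 4 * ‖w - x‖ := by gcongr
      have h4 : M / 4 * R = ‖L‖ + |q - θ x| + 1 + M / 4 := by simp only [R]; field_simp
      linarith
    have h3 := le_abs_self (q - θ x)
    have h4 := abs_nonneg (q - θ x)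
    nlinarith

/-- **Whitney extension for `C^{1,1}` jets.** A bounded family of compatible 1-jets extends to a
`C^{1,1}` function, equivariantly with respect to translations preserving the jets. -/
theorem exists_extension_of_jets [FiniteDimensional ℝ E] {A C : ℝ} (hC : 0 < C)
    (hfA : ∀ i, |f i| ≤ A) (hgA : ∀ i, ‖g i‖ ≤ A)
    (hf : ∀ i j, |f i - f j - ⟪g j, P i - P j⟫_ℝ| ≤ C * ‖P i - P j‖ ^ 2)
    (hg : ∀ i j, ‖g i - g j‖ ≤ C * ‖P i - P j‖) :
    ∃ (S : E → ℝ) (b : E → E), (∀ i, S (P i) = f i ∧ b (P i) = g i) ∧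
      (∀ x y, |S (x + y) - S x - ⟪b x, y⟫_ℝ| ≤ 12 * C * ‖y‖ ^ 2) ∧
      ∀ (τ : E) (e : ι ≃ ι), (∀ i, P (e i) = P i + τ ∧ f (e i) = f i ∧ g (e i) = g i) →
        ∀ x, S (x + τ) = S x := by
  set M := 8 * C with hMC
  have hM : 0 < M := by positivity
  have hb := bddBelow_jetMajorant (P := P) hM hfA hgA
  choose W hW using exists_forall_jetEnvelope_le hM hb
  have hWle : ∀ x w, jetEnvelope M P f g w - M / 2 * ‖x - w‖ ^ 2 ≤
      jetEnvelope M P f g (W x) - M / 2 * ‖x - W x‖ ^ 2 := fun x w =>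
    (hW x w).trans (sub_le_self _ (by positivity))
  refine ⟨fun x => jetEnvelope M P f g (W x) - M / 2 * ‖x - W x‖ ^ 2, fun x => M • (W x - x),
    fun i => ?_, fun x y => ?_, fun τ e he x => ?_⟩
  · have h1 : f i ≤ jetEnvelope M P f g (P i + M⁻¹ • g i) -
        M / 2 * ‖P i - (P i + M⁻¹ • g i)‖ ^ 2 := by
      rw [le_sub_iff_add_le]
      refine le_ciInf fun j => ?_
      rw [← le_sub_iff_add_le]
      exact jetMajorant_touch hC (hf i j) (hg i j)
    have h2 : jetEnvelope M P f g (W (P i)) ≤ _ := ciInf_le (hb (W (P i))) i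
    have h3 := jetMajorant_sub hM (P i) (f i) (g i) (W (P i))
    have h4 := hWle (P i) (P i + M⁻¹ • g i)
    have h5 : M / 4 * ‖W (P i) - (P i + M⁻¹ • g i)‖ ^ 2 ≤ 0 := by linarith
    have h6 : ‖W (P i) - (P i + M⁻¹ • g i)‖ ^ 2 = 0 :=
      le_antisymm (nonpos_of_mul_nonpos_right h5 (by positivity)) (by positivity)
    have h7 : W (P i) = P i + M⁻¹ • g i := by
      rwa [sq_eq_zero_iff, norm_eq_zero, sub_eq_zero] at h6
    constructor
    · have : 0 ≤ M / 4 * ‖W (P i) - (P i + M⁻¹ • g i)‖ ^ 2 := by positivity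
      simp only
      linarith
    · simp only [h7, add_sub_cancel_left, smul_smul, mul_inv_cancel₀ hM.ne', one_smul]
  · have key : ∀ w, M / 2 * ‖x + y - w‖ ^ 2 =
        M / 2 * ‖x - w‖ ^ 2 - M * ⟪w - x, y⟫_ℝ + M / 2 * ‖y‖ ^ 2 := by
      intro w
      have : x + y - w = y - (w - x) := by abel
      rw [this, norm_sub_sq_real, norm_sub_rev x w, real_inner_comm]; ring
    have h1 := hWle (x + y) (W x)
    have h2 := hW x (W (x + y))
    rw [key, key] at h1
    simp only
    rw [key, real_inner_smul_left]
    have h3 : ⟪W (x + y) - x, y⟫_ℝ = ⟪W x - x, y⟫_ℝ + ⟪W (x + y) - W x, y⟫_ℝ := by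
      rw [← inner_add_left]; congr 1; abel
    rw [h3] at h1 ⊢
    have h4 := real_inner_le_norm (W (x + y) - W x) y
    set D := ‖W (x + y) - W x‖
    have h5 : M * ⟪W (x + y) - W x, y⟫_ℝ ≤ M / 8 * D ^ 2 + 2 * M * ‖y‖ ^ 2 := by
      have : 0 ≤ M / 8 * (D - 4 * ‖y‖) ^ 2 := by positivity
      nlinarith
    have h6 : 12 * C = 3 / 2 * M := by rw [hMC]; ring
    have h7 : 0 ≤ M * ‖y‖ ^ 2 := by positivity
    rw [h6, abs_le]
    constructor <;> linarith
  · have hφ : ∀ w, jetEnvelope M P f g (w + τ) = jetEnvelope M P f g w := by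
      intro w
      unfold jetEnvelope
      rw [← e.iInf_comp]
      congr 1
      ext i
      simp only [jetMajorant, (he i).1, (he i).2.1, (he i).2.2, add_sub_add_right_eq_sub]
    have h1 := hWle (x + τ) (W x + τ)
    have h2 := hWle x (W (x + τ) - τ)
    have h3 := hφ (W (x + τ) - τ)
    rw [sub_add_cancel] at h3
    have h4 : x - (W (x + τ) - τ) = x + τ - W (x + τ) := by abel
    rw [hφ, add_sub_add_right_eq_sub] at h1
    rw [← h3, h4] at h2
    exact le_antisymm h2 h1

end Extension

theorem exists_mem_Icc_two_pi (u : ℝ) : ∃ k : ℤ, u + k * (2 * π) ∈ Set.Icc 0 (2 * π) := by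
  obtain ⟨k, hk, -⟩ := existsUnique_add_zsmul_mem_Ico Real.two_pi_pos u 0
  exact ⟨k, by simpa using Set.Ico_subset_Icc_self hk⟩

theorem HasDerivAt.fst_comp {F F' : Type*} [NormedAddCommGroup F] [NormedSpace ℝ F]
    [NormedAddCommGroup F'] [NormedSpace ℝ F'] {f : ℝ → F × F'} {f' : F × F'} {x : ℝ}
    (h : HasDerivAt f f' x) : HasDerivAt (fun x => (f x).1) f'.1 x :=
  (ContinuousLinearMap.fst ℝ F F').hasFDerivAt.comp_hasDerivAt x h

theorem HasDerivAt.snd_comp {F F' : Type*} [NormedAddCommGroup F] [NormedSpace ℝ F]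
    [NormedAddCommGroup F'] [NormedSpace ℝ F'] {f : ℝ → F × F'} {f' : F × F'} {x : ℝ}
    (h : HasDerivAt f f' x) : HasDerivAt (fun x => (f x).2) f'.2 x :=
  (ContinuousLinearMap.snd ℝ F F').hasFDerivAt.comp_hasDerivAt x h

section Periodic

variable {F : Type*} [NormedAddCommGroup F] {Φ : ℝ × ℝ → F}

theorem exists_norm_le_of_periodic (hΦ : Continuous Φ)
    (hper : ∀ t ∈ Set.Icc (0 : ℝ) 1, ∀ u, Φ (t, u + 2 * π) = Φ (t, u)) :
    ∃ B, ∀ t ∈ Set.Icc (0 : ℝ) 1, ∀ u, ‖Φ (t, u)‖ ≤ B := by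
  obtain ⟨B, hB⟩ := ((isCompact_Icc (a := (0 : ℝ)) (b := 1)).prod
    (isCompact_Icc (a := (0 : ℝ)) (b := 2 * π))).exists_bound_of_continuousOn hΦ.continuousOn
  refine ⟨B, fun t ht u => ?_⟩
  obtain ⟨k, hk⟩ := exists_mem_Icc_two_pi u
  have h1 := Function.Periodic.int_mul (f := fun u => Φ (t, u)) (hper t ht) k u
  simp only at h1
  rw [← h1]
  exact hB _ ⟨ht, hk⟩

theorem exists_norm_sub_le_of_periodic (hΦ : Continuous Φ)
    (hper : ∀ t ∈ Set.Icc (0 : ℝ) 1, ∀ u, Φ (t, u + 2 * π) = Φ (t, u)) {η : ℝ} (hη : 0 < η) :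
    ∃ δ > 0, ∀ s ∈ Set.Icc (0 : ℝ) 1, ∀ t ∈ Set.Icc (0 : ℝ) 1, |s - t| < δ →
      ∀ u, ‖Φ (t, u) - Φ (s, u)‖ ≤ η := by
  have huc := ((isCompact_Icc (a := (0 : ℝ)) (b := 1)).prod
    (isCompact_Icc (a := (0 : ℝ)) (b := 2 * π))).uniformContinuousOn_of_continuous hΦ.continuousOn
  obtain ⟨δ, hδ, h⟩ := Metric.uniformContinuousOn_iff.1 huc η hη
  refine ⟨δ, hδ, fun s hs t ht hst u => ?_⟩
  obtain ⟨k, hk⟩ := exists_mem_Icc_two_pi u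
  have h1 := Function.Periodic.int_mul (f := fun u => Φ (t, u)) (hper t ht) k u
  have h2 := Function.Periodic.int_mul (f := fun u => Φ (s, u)) (hper s hs) k u
  simp only at h1 h2
  rw [← h1, ← h2, ← dist_eq_norm]
  refine (h _ ⟨ht, hk⟩ _ ⟨hs, hk⟩ ?_).le
  rw [Prod.dist_eq, dist_self, max_lt_iff, dist_comm]
  exact ⟨hst, hδ⟩

end Periodic

/-- A `C¹` family of Legendrian knots `u ↦ H (t, u)`, `t ∈ [0, 1]`, with `u`-derivative `D`. -/
structure IsLegendrianIsotopy (H D : ℝ × ℝ → ℝ × ℝ × ℝ) : Prop where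
  continuous : Continuous H
  continuous_deriv : Continuous D
  hasDerivAt : ∀ t u, HasDerivAt (fun u => H (t, u)) (D (t, u)) u
  equivariant : ∀ t ∈ Set.Icc (0 : ℝ) 1, ∀ u, H (t, u + 2 * π) = H (t, u) + (2 * π, 0, 0)
  deriv_ne_zero : ∀ t ∈ Set.Icc (0 : ℝ) 1, ∀ u, D (t, u) ≠ 0
  injective : ∀ t ∈ Set.Icc (0 : ℝ) 1, Function.Injective fun u => H (t, u)
  legendrian : ∀ t ∈ Set.Icc (0 : ℝ) 1, ∀ u, (D (t, u)).2.2 = (H (t, u)).2.1 * (D (t, u)).1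

namespace IsLegendrianIsotopy

variable {H D : ℝ × ℝ → ℝ × ℝ × ℝ}

theorem deriv_periodic (h : IsLegendrianIsotopy H D) (t : ℝ) (ht : t ∈ Set.Icc (0 : ℝ) 1) (u : ℝ) :
    D (t, u + 2 * π) = D (t, u) := by
  have h1 : HasDerivAt (fun u => H (t, u + 2 * π)) (D (t, u + 2 * π)) u := by
    simpa using (h.hasDerivAt t (u + 2 * π)).comp_add_const u (2 * π)
  simp_rw [h.equivariant t ht] at h1
  exact h1.unique ((h.hasDerivAt t u).add_const _)

theorem sub_periodic (h : IsLegendrianIsotopy H D) (t : ℝ) (ht : t ∈ Set.Icc (0 : ℝ) 1) (u : ℝ) :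
    H (t, u + 2 * π) - (u + 2 * π, 0, 0) = H (t, u) - (u, 0, 0) := by
  rw [h.equivariant t ht]
  ext <;> simp

theorem exists_bound (h : IsLegendrianIsotopy H D) :
    ∃ B > 0, ∀ t ∈ Set.Icc (0 : ℝ) 1, ∀ u, ‖D (t, u)‖ ≤ B ∧ ‖H (t, u) - (u, 0, 0)‖ ≤ B := by
  obtain ⟨B₁, hB₁⟩ := exists_norm_le_of_periodic h.continuous_deriv h.deriv_periodic
  obtain ⟨B₂, hB₂⟩ := exists_norm_le_of_periodic (Φ := fun p => H p - (p.2, 0, 0))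
    (by have := h.continuous; fun_prop) h.sub_periodic
  exact ⟨max (max B₁ B₂) 1, by positivity, fun t ht u =>
    ⟨(hB₁ t ht u).trans ((le_max_left _ _).trans (le_max_left _ _)),
      (hB₂ t ht u).trans ((le_max_right _ _).trans (le_max_left _ _))⟩⟩

/-- The curves of a Legendrian isotopy are uniformly bi-Lipschitz. -/
theorem exists_mul_abs_sub_le (h : IsLegendrianIsotopy H D) :
    ∃ κ > 0, ∀ t ∈ Set.Icc (0 : ℝ) 1, ∀ u v, κ * |u - v| ≤ ‖H (t, u) - H (t, v)‖ := by
  obtain ⟨B, hB, hbd⟩ := h.exists_bound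
  let A : ℝ × ℝ × ℝ → ℝ × ℝ × ℝ := fun p => ∫ θ in (0 : ℝ)..1, D (p.1, p.2.1 + θ * p.2.2)
  have hDc := h.continuous_deriv
  have hAc : Continuous A :=
    intervalIntegral.continuous_parametric_intervalIntegral_of_continuous' (by fun_prop) 0 1
  have hA : ∀ t v d, H (t, v + d) - H (t, v) = d • A (t, v, d) := by
    intro t v d
    have h1 : ∀ θ ∈ Set.uIcc (0 : ℝ) 1,
        HasDerivAt (fun θ : ℝ => H (t, v + θ * d)) (d • D (t, v + θ * d)) θ := fun θ _ => by
      have h2 : HasDerivAt (fun θ : ℝ => v + θ * d) d θ := by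
        simpa using ((hasDerivAt_id θ).mul_const d).const_add v
      exact (h.hasDerivAt t (v + θ * d)).scomp θ h2
    have h3 := intervalIntegral.integral_eq_sub_of_hasDerivAt h1
      ((by fun_prop : Continuous fun θ : ℝ => d • D (t, v + θ * d)).intervalIntegrable 0 1)
    rw [intervalIntegral.integral_smul] at h3
    simpa using h3.symm
  have hA0 : ∀ t ∈ Set.Icc (0 : ℝ) 1, ∀ v d, A (t, v, d) ≠ 0 := by
    intro t ht v d h0
    rcases eq_or_ne d 0 with rfl | hd
    · refine h.deriv_ne_zero t ht v ?_
      simpa [A] using h0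
    · have h1 := hA t v d
      rw [h0, smul_zero, sub_eq_zero] at h1
      exact hd (by simpa using h.injective t ht h1)
  obtain ⟨κ, hκ, hκ'⟩ := ((isCompact_Icc (a := (0 : ℝ)) (b := 1)).prod
    ((isCompact_Icc (a := (0 : ℝ)) (b := 2 * π)).prod
    (isCompact_Icc (a := -(4 * B)) (b := 4 * B)))).exists_forall_le' (f := fun p => ‖A p‖)
    hAc.norm.continuousOn (a := 0) fun p hp => norm_pos_iff.2 (hA0 p.1 hp.1 p.2.1 p.2.2)
  refine ⟨min κ (1 / 2), by positivity, fun t ht u v => ?_⟩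
  rcases le_or_gt |u - v| (4 * B) with hL | hL
  · obtain ⟨k, hk⟩ := exists_mem_Icc_two_pi v
    have h1 : ∀ w, H (t, w + k * (2 * π)) - (w + k * (2 * π), 0, 0) = H (t, w) - (w, 0, 0) :=
      fun w => Function.Periodic.int_mul (f := fun u => H (t, u) - (u, 0, 0))
        (h.sub_periodic t ht) k w
    have h2 : H (t, u) - H (t, v) = H (t, u + k * (2 * π)) - H (t, v + k * (2 * π)) := by
      have e1 := h1 u
      have e2 := h1 v
      rw [sub_eq_iff_eq_add] at e1 e2
      rw [e1, e2]
      refine Prod.ext ?_ (by simp)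
      simp only [Prod.fst_add, Prod.fst_sub]
      ring
    have h3 : u + k * (2 * π) = v + k * (2 * π) + (u - v) := by ring
    rw [h2, h3, hA, norm_smul, Real.norm_eq_abs, mul_comm]
    exact mul_le_mul_of_nonneg_left ((min_le_left _ _).trans
      (hκ' (t, v + k * (2 * π), u - v) ⟨ht, hk, abs_le.1 hL⟩)) (abs_nonneg _)
  · have h1 := (norm_fst_le _).trans (hbd t ht u).2
    have h2 := (norm_fst_le _).trans (hbd t ht v).2
    have h3 := norm_fst_le (H (t, u) - H (t, v))
    simp only [Prod.fst_sub, Real.norm_eq_abs] at h1 h2 h3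
    refine le_trans ?_ h3
    have h4 : |u - v| ≤ |(H (t, u)).1 - (H (t, v)).1| + B + B := by
      have h6 := le_abs_self ((H (t, u)).1 - (H (t, v)).1)
      have h7 := neg_abs_le ((H (t, u)).1 - (H (t, v)).1)
      rw [abs_le] at h1 h2 ⊢
      constructor <;> linarith
    have h5 : min κ (1 / 2) * |u - v| ≤ 1 / 2 * |u - v| := by gcongr; exact min_le_right _ _
    linarith

theorem norm_sub_le_of_hasDerivAt {F : Type*} [NormedAddCommGroup F] [NormedSpace ℝ F]
    {f f' : ℝ → F} {u v C : ℝ} (hf : ∀ w, HasDerivAt f (f' w) w)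
    (hC : ∀ w ∈ Set.uIcc v u, ‖f' w‖ ≤ C) : ‖f u - f v‖ ≤ C * |u - v| :=
  (convex_uIcc v u).norm_image_sub_le_of_norm_hasDerivWithin_le
    (fun w _ => (hf w).hasDerivWithinAt) hC Set.left_mem_uIcc Set.right_mem_uIcc

/-- The 1-jets that carry the curve at time `s` to the curve at time `t` satisfy Whitney's
conditions with arbitrarily small constants when `s` and `t` are close. -/
theorem exists_jet_bounds (h : IsLegendrianIsotopy H D) {C : ℝ} (hC : 0 < C) :
    ∃ δ > 0, ∀ s ∈ Set.Icc (0 : ℝ) 1, ∀ t ∈ Set.Icc (0 : ℝ) 1, |s - t| < δ →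
      ∀ P : ℝ → ℝ × ℝ × ℝ, (∀ u, P u = ((H (t, u)).1, (H (s, u)).2)) →
      ∀ g : ℝ → ℝ × ℝ × ℝ, (∀ u, g u = H (t, u) - H (s, u)) →
      ∀ f : ℝ → ℝ, (∀ u, f u = (g u).2.2 - (H (s, u)).2.1 * (g u).1) →
      ∀ u v, |f u| ≤ C ∧ ‖g u‖ ≤ C ∧ ‖g u - g v‖ ≤ C * ‖P u - P v‖ ∧
        |f u - f v - ((g v).2.1 * (P u - P v).1 - (g v).1 * (P u - P v).2.1)| ≤
          C * ‖P u - P v‖ ^ 2 := by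
  obtain ⟨B, hB, hbd⟩ := h.exists_bound
  obtain ⟨κ, hκ, hlip⟩ := h.exists_mul_abs_sub_le
  obtain ⟨η, hη, hη1, hη2, hη3, hη4⟩ : ∃ η > 0, η ≤ κ / 2 ∧ η * (1 + B) ≤ C ∧ η ≤ C * (κ / 2) ∧
      2 * η * B ≤ C * (κ / 2) ^ 2 := by
    refine ⟨min (min (κ / 2) (C / (1 + B))) (min (C * (κ / 2)) (C * (κ / 2) ^ 2 / (2 * B))),
      by positivity, (min_le_left _ _).trans (min_le_left _ _), ?_,
      (min_le_right _ _).trans (min_le_left _ _), ?_⟩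
    · rw [← le_div_iff₀ (by positivity)]
      exact (min_le_left _ _).trans (min_le_right _ _)
    · rw [mul_right_comm, mul_comm, ← le_div_iff₀ (by positivity)]
      exact (min_le_right _ _).trans (min_le_right _ _)
  obtain ⟨δ₁, hδ₁, hd₁⟩ := exists_norm_sub_le_of_periodic h.continuous_deriv h.deriv_periodic hη
  obtain ⟨δ₂, hδ₂, hd₂⟩ := exists_norm_sub_le_of_periodic (Φ := fun p => H p - (p.2, 0, 0))
    (by have := h.continuous; fun_prop) h.sub_periodic hη
  refine ⟨min δ₁ δ₂, by positivity, fun s hs t ht hst P hP g hg f hf u v => ?_⟩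
  have hgn : ∀ u, ‖g u‖ ≤ η := fun u => by
    have := hd₂ s hs t ht (hst.trans_le (min_le_right _ _)) u
    rwa [sub_sub_sub_cancel_right, ← hg] at this
  have hgd : ∀ u, HasDerivAt g (D (t, u) - D (s, u)) u := fun u => by
    rw [funext hg]
    exact (h.hasDerivAt t u).sub (h.hasDerivAt s u)
  have hglip : ∀ u v, ‖g u - g v‖ ≤ η * |u - v| := fun u v =>
    norm_sub_le_of_hasDerivAt hgd fun w _ => hd₁ s hs t ht (hst.trans_le (min_le_left _ _)) w
  have hPlip : κ / 2 * |u - v| ≤ ‖P u - P v‖ := by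
    have h1 := hlip s hs u v
    have h2 : H (s, u) - H (s, v) = (P u - P v) - ((g u - g v).1, 0) := by
      rw [hP, hP, hg, hg]
      refine Prod.ext ?_ (by simp)
      simp only [Prod.fst_sub]
      ring
    have h3 : ‖(((g u - g v).1, 0) : ℝ × ℝ × ℝ)‖ ≤ η * |u - v| := by
      refine le_trans ?_ (hglip u v)
      rw [norm_prod_le_iff]
      exact ⟨norm_fst_le (g u - g v), by simp⟩
    have h4 : ‖H (s, u) - H (s, v)‖ ≤ ‖P u - P v‖ + η * |u - v| := by
      rw [h2]; exact (norm_sub_le _ _).trans (by gcongr)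
    nlinarith [abs_nonneg (u - v)]
  have hY : |(H (s, u)).2.1| ≤ B := by
    have h1 := ((norm_fst_le _).trans (norm_snd_le _)).trans (hbd s hs u).2
    simpa using h1
  have hg1 : ∀ p : ℝ × ℝ × ℝ, |p.1| ≤ ‖p‖ := fun p => norm_fst_le p
  have hg2 : ∀ p : ℝ × ℝ × ℝ, |p.2.1| ≤ ‖p‖ := fun p => (norm_fst_le _).trans (norm_snd_le p)
  have hg3 : ∀ p : ℝ × ℝ × ℝ, |p.2.2| ≤ ‖p‖ := fun p => (norm_snd_le _).trans (norm_snd_le p)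
  refine ⟨?_, ?_, ?_, ?_⟩
  · rw [hf]
    have h1 := (hg3 (g u)).trans (hgn u)
    have h2 : |(H (s, u)).2.1 * (g u).1| ≤ B * η := by
      rw [abs_mul]; exact mul_le_mul hY ((hg1 _).trans (hgn u)) (abs_nonneg _) hB.le
    refine (abs_sub _ _).trans ?_
    linarith
  · nlinarith [hgn u]
  · refine (hglip u v).trans ?_
    calc η * |u - v| ≤ C * (κ / 2) * |u - v| := by gcongr
      _ = C * (κ / 2 * |u - v|) := by ring
      _ ≤ _ := by gcongr
  · have hd : ∀ w, HasDerivAt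
        (fun w => f w - ((g v).2.1 * (P w).1 - (g v).1 * (P w).2.1))
        ((g w - g v).2.1 * (D (t, w)).1 - (g w - g v).1 * (D (s, w)).2.1) w := by
      intro w
      have e1 := (hgd w).fst_comp
      have e2 := (hgd w).snd_comp.fst_comp
      have e3 := (hgd w).snd_comp.snd_comp
      have e4 := (h.hasDerivAt s w).snd_comp.fst_comp
      have e5 := (h.hasDerivAt t w).fst_comp
      have e6 := (e3.sub (e4.mul e1)).sub ((e5.const_mul (g v).2.1).sub (e4.const_mul (g v).1))
      refine (e6.congr_of_eventuallyEq (Filter.Eventually.of_forall fun w => ?_)).congr_deriv ?_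
      · simp [hf, hP]
      · have l1 := h.legendrian s hs w
        have l2 := h.legendrian t ht w
        simp only [hg w, Prod.fst_sub, Prod.snd_sub, l1, l2]
        ring
    have h1 := norm_sub_le_of_hasDerivAt (u := u) (v := v) (C := 2 * η * B * |u - v|) hd
      fun w hw => ?_
    · have e : f u - f v - ((g v).2.1 * (P u - P v).1 - (g v).1 * (P u - P v).2.1) =
          (f u - ((g v).2.1 * (P u).1 - (g v).1 * (P u).2.1)) -
          (f v - ((g v).2.1 * (P v).1 - (g v).1 * (P v).2.1)) := by
        simp only [Prod.fst_sub, Prod.snd_sub]; ring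
      rw [e]
      refine h1.trans ?_
      calc 2 * η * B * |u - v| * |u - v| ≤ C * (κ / 2) ^ 2 * |u - v| * |u - v| := by gcongr
        _ = C * (κ / 2 * |u - v|) ^ 2 := by ring
        _ ≤ _ := by gcongr
    · have hwv : |w - v| ≤ |u - v| := Set.abs_sub_left_of_mem_uIcc hw
      have h2 : ‖g w - g v‖ ≤ η * |u - v| := (hglip w v).trans (by gcongr)
      have h3 : |(g w - g v).2.1 * (D (t, w)).1| ≤ η * |u - v| * B := by
        rw [abs_mul]
        exact mul_le_mul ((hg2 _).trans h2) ((hg1 _).trans (hbd t ht w).1) (abs_nonneg _)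
          (by positivity)
      have h4 : |(g w - g v).1 * (D (s, w)).2.1| ≤ η * |u - v| * B := by
        rw [abs_mul]
        exact mul_le_mul ((hg1 _).trans h2) ((hg2 _).trans (hbd s hs w).1) (abs_nonneg _)
          (by positivity)
      refine (abs_sub _ _).trans ?_
      linarith

end IsLegendrianIsotopy

section ExtensionByZero

open scoped InnerProductSpace

/-- Small compatible jets extend to a `C^{1,1}` function vanishing to first order on a prescribed
set at distance at least one. -/
theorem exists_extension_of_jets_of_dist {E ι : Type*} [NormedAddCommGroup E]
    [InnerProductSpace ℝ E] [FiniteDimensional ℝ E] [Nonempty ι] {P : ι → E} {f : ι → ℝ} {g : ι → E}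
    {C : ℝ} (hC : 0 < C) (hfC : ∀ i, |f i| ≤ C / 2) (hgC : ∀ i, ‖g i‖ ≤ C / 2)
    (hf : ∀ i j, |f i - f j - ⟪g j, P i - P j⟫_ℝ| ≤ C * ‖P i - P j‖ ^ 2)
    (hg : ∀ i j, ‖g i - g j‖ ≤ C * ‖P i - P j‖) {Z : Set E} (hZ : ∀ i, ∀ w ∈ Z, 1 ≤ ‖P i - w‖) :
    ∃ (S : E → ℝ) (b : E → E), (∀ i, S (P i) = f i ∧ b (P i) = g i) ∧
      (∀ w ∈ Z, S w = 0 ∧ b w = 0) ∧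
      (∀ x y, |S (x + y) - S x - ⟪b x, y⟫_ℝ| ≤ 12 * C * ‖y‖ ^ 2) ∧
      ∀ (τ : E) (e : ι ≃ ι), (∀ i, P (e i) = P i + τ ∧ f (e i) = f i ∧ g (e i) = g i) →
        (∀ w, w + τ ∈ Z ↔ w ∈ Z) → ∀ x, S (x + τ) = S x := by
  have hd : ∀ {d : ℝ}, 1 ≤ d → d ≤ d ^ 2 := fun h => by nlinarith
  obtain ⟨S, b, hS, hT, hτ⟩ := exists_extension_of_jets (ι := ι ⊕ Z)
    (P := Sum.elim P Subtype.val) (f := Sum.elim f 0) (g := Sum.elim g 0) (A := C / 2) hC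
    (by rintro (i | i) <;> simp [hfC, (half_pos hC).le])
    (by rintro (i | i) <;> simp [hgC, (half_pos hC).le])
    (by
      rintro (i | i) (j | j)
      · exact hf i j
      · have h1 := hZ i j j.2
        have h2 := hd h1
        have h3 := hfC i
        simp only [Sum.elim_inl, Sum.elim_inr, Pi.zero_apply, inner_zero_left, sub_zero]
        nlinarith
      · have h1 := hZ j i i.2
        have h2 := hd h1
        have h3 := hfC j
        have h4 := abs_real_inner_le_norm (g j) (i - P j)
        rw [norm_sub_rev (i : E)] at h4
        simp only [Sum.elim_inl, Sum.elim_inr, Pi.zero_apply, zero_sub]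
        rw [norm_sub_rev (i : E)]
        have h5 := abs_sub (-f j) ⟪g j, i - P j⟫_ℝ
        rw [abs_neg] at h5
        have h6 := mul_le_mul_of_nonneg_right (hgC j) (norm_nonneg (P j - i))
        nlinarith
      · simp; positivity)
    (by
      rintro (i | i) (j | j)
      · exact hg i j
      · have h1 := hZ i j j.2
        have h2 := hgC i
        simp only [Sum.elim_inl, Sum.elim_inr, Pi.zero_apply, sub_zero]
        nlinarith
      · have h1 := hZ j i i.2
        have h2 := hgC j
        simp only [Sum.elim_inl, Sum.elim_inr, Pi.zero_apply, zero_sub, norm_neg]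
        rw [norm_sub_rev (i : E)]
        nlinarith
      · simp; positivity)
  refine ⟨S, b, fun i => hS (Sum.inl i), fun w hw => hS (Sum.inr ⟨w, hw⟩), hT,
    fun τ e he hZτ => hτ τ (Equiv.sumCongr e
      ((Equiv.addRight τ).subtypeEquiv fun w => (hZτ w).symm)) ?_⟩
  rintro (i | i)
  · exact he i
  · exact ⟨rfl, rfl, rfl⟩

end ExtensionByZero

/-- A small `C¹` generating function of one step of a Legendrian isotopy. -/
structure IsStep (ε : ℝ) (S : ℝ × ℝ × ℝ → ℝ) (S' : ℝ × ℝ × ℝ → (ℝ × ℝ × ℝ →L[ℝ] ℝ)) : Prop where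
  hasFDerivAt : ∀ p, HasFDerivAt S (S' p) p
  continuous_deriv : Continuous S'
  periodic : ∀ x q, S (x + 2 * π, q) = S (x, q)
  abs_le : ∀ p, |S p| ≤ ε
  abs_deriv_x_le : ∀ p, |S' p (1, 0, 0)| ≤ 1 / 2
  abs_deriv_y_le : ∀ p, |S' p (0, 1, 0)| ≤ 1 / 2
  abs_deriv_z_le : ∀ p, |S' p (0, 0, 1)| ≤ 1 / 2

/-- The contact transformation generated by `S` maps `L` into `L'`. -/
def Carries (S : ℝ × ℝ × ℝ → ℝ) (S' : ℝ × ℝ × ℝ → (ℝ × ℝ × ℝ →L[ℝ] ℝ))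
    (L L' : Set (ℝ × ℝ × ℝ)) : Prop :=
  ∀ x y z x' y', (x, y, z) ∈ L → y' = (1 + S' (x', y', z) (0, 0, 1)) * y →
    x' - x = -S' (x', y', z) (0, 1, 0) →
    (x', y' + S' (x', y', z) (1, 0, 0), z + y' * (x' - x) + S (x', y', z)) ∈ L'

theorem isStep_zero {ε : ℝ} (hε : 0 ≤ ε) : IsStep ε 0 0 where
  hasFDerivAt p := hasFDerivAt_const 0 p
  continuous_deriv := continuous_const
  periodic _ _ := rfl
  abs_le p := by simpa using hε
  abs_deriv_x_le p := by norm_num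
  abs_deriv_y_le p := by norm_num
  abs_deriv_z_le p := by norm_num

theorem carries_zero (L : Set (ℝ × ℝ × ℝ)) : Carries 0 0 L L := by
  intro x y z x' y' h hy hx
  simp only [Pi.zero_apply, zero_apply, add_zero, one_mul, neg_zero,
    sub_eq_zero] at hy hx ⊢
  subst hy hx
  simpa using h

/-- The coordinate identification with Euclidean space. -/
noncomputable def toEuclideanThree : ℝ × ℝ × ℝ →L[ℝ] EuclideanSpace ℝ (Fin 3) :=
  LinearMap.toContinuousLinearMap
    { toFun := fun p => !₂[p.1, p.2.1, p.2.2]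
      map_add' := fun p q => by ext i; fin_cases i <;> rfl
      map_smul' := fun c p => by ext i; fin_cases i <;> rfl }

theorem toEuclideanThree_apply (p : ℝ × ℝ × ℝ) : toEuclideanThree p = !₂[p.1, p.2.1, p.2.2] := rfl

theorem norm_toEuclideanThree_sq (p : ℝ × ℝ × ℝ) :
    ‖toEuclideanThree p‖ ^ 2 = p.1 ^ 2 + p.2.1 ^ 2 + p.2.2 ^ 2 := by
  rw [toEuclideanThree_apply, EuclideanSpace.norm_sq_eq, Fin.sum_univ_three]
  simp

theorem abs_apply_le_norm (w : EuclideanSpace ℝ (Fin 3)) (i : Fin 3) : |w i| ≤ ‖w‖ :=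
  PiLp.norm_apply_le w i

theorem norm_le_norm_toEuclideanThree (p : ℝ × ℝ × ℝ) : ‖p‖ ≤ ‖toEuclideanThree p‖ := by
  rw [norm_prod_le_iff, norm_prod_le_iff]
  exact ⟨abs_apply_le_norm (toEuclideanThree p) 0, abs_apply_le_norm (toEuclideanThree p) 1,
    abs_apply_le_norm (toEuclideanThree p) 2⟩

theorem norm_toEuclideanThree_le (p : ℝ × ℝ × ℝ) :
    ‖toEuclideanThree p‖ ≤ |p.1| + |p.2.1| + |p.2.2| := by
  refine abs_le_of_sq_le_sq' ?_ (by positivity) |>.2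
  rw [norm_toEuclideanThree_sq, ← sq_abs p.1, ← sq_abs p.2.1, ← sq_abs p.2.2]
  have h1 := abs_nonneg p.1
  have h2 := abs_nonneg p.2.1
  have h3 := abs_nonneg p.2.2
  nlinarith [mul_nonneg h1 h2, mul_nonneg h1 h3, mul_nonneg h2 h3]

theorem inner_toEuclideanThree (w : EuclideanSpace ℝ (Fin 3)) (p : ℝ × ℝ × ℝ) :
    inner ℝ w (toEuclideanThree p) = w 0 * p.1 + w 1 * p.2.1 + w 2 * p.2.2 := by
  rw [toEuclideanThree_apply, PiLp.inner_apply, Fin.sum_univ_three]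
  simp [mul_comm]

/-- Nearby curves of a Legendrian isotopy are related by a step. -/
theorem IsLegendrianIsotopy.exists_step {H D : ℝ × ℝ → ℝ × ℝ × ℝ} (h : IsLegendrianIsotopy H D)
    {ε : ℝ} (hε : 0 < ε) :
    ∃ δ > 0, ∀ s ∈ Set.Icc (0 : ℝ) 1, ∀ t ∈ Set.Icc (0 : ℝ) 1, |s - t| < δ →
      ∃ S S', IsStep ε S S' ∧
        Carries S S' (Set.range fun u => H (s, u)) (Set.range fun u => H (t, u)) := by
  obtain ⟨B, hB, hbd⟩ := h.exists_bound
  set R := B + 1 with hR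
  obtain ⟨C, hC, hC1, hC2, hC3⟩ : ∃ C > 0, 48 * C * R ^ 2 ≤ ε ∧ 144 * C * R ≤ 1 / 2 ∧
      72 * C * (1 + R) < 1 := by
    have hR0 : 0 < R := by positivity
    refine ⟨min (ε / (48 * R ^ 2)) (1 / (300 * (1 + R))), by positivity, ?_, ?_, ?_⟩
    · rw [mul_right_comm, mul_comm, ← le_div_iff₀ (by positivity)]
      exact min_le_left _ _
    · have h1 : min (ε / (48 * R ^ 2)) (1 / (300 * (1 + R))) * (300 * (1 + R)) ≤ 1 := by
        rw [← le_div_iff₀ (by positivity)]; exact min_le_right _ _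
      have h2 : 0 < min (ε / (48 * R ^ 2)) (1 / (300 * (1 + R))) := by positivity
      nlinarith
    · have h1 : min (ε / (48 * R ^ 2)) (1 / (300 * (1 + R))) * (300 * (1 + R)) ≤ 1 := by
        rw [← le_div_iff₀ (by positivity)]; exact min_le_right _ _
      nlinarith
  obtain ⟨δ, hδ, hjet⟩ := h.exists_jet_bounds (C := C / 4) (by positivity)
  refine ⟨δ, hδ, fun s hs t ht hst => ?_⟩
  let P : ℝ → ℝ × ℝ × ℝ := fun u => ((H (t, u)).1, (H (s, u)).2)
  let g : ℝ → ℝ × ℝ × ℝ := fun u => H (t, u) - H (s, u)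
  let f : ℝ → ℝ := fun u => (g u).2.2 - (H (s, u)).2.1 * (g u).1
  have hj := hjet s hs t ht hst P (fun _ => rfl) g (fun _ => rfl) f (fun _ => rfl)
  let gE : ℝ → EuclideanSpace ℝ (Fin 3) := fun u => toEuclideanThree ((g u).2.1, -(g u).1, 0)
  have hrot : ∀ p : ℝ × ℝ × ℝ, ‖toEuclideanThree (p.2.1, -p.1, 0)‖ ≤ 2 * ‖p‖ := fun p => by
    have h1 : |p.1| ≤ ‖p‖ := norm_fst_le p
    have h2 : |p.2.1| ≤ ‖p‖ := (norm_fst_le _).trans (norm_snd_le p)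
    refine (norm_toEuclideanThree_le _).trans ?_
    simp only [abs_neg, abs_zero]
    linarith
  have hYZ : ∀ u, |(H (s, u)).2.1| ≤ B ∧ |(H (s, u)).2.2| ≤ B := fun u => by
    have h1 := ((norm_fst_le _).trans (norm_snd_le _)).trans (hbd s hs u).2
    have h2 := ((norm_snd_le _).trans (norm_snd_le _)).trans (hbd s hs u).2
    exact ⟨by simpa using h1, by simpa using h2⟩
  obtain ⟨S, b, hS, hZ, hT, hτ⟩ := exists_extension_of_jets_of_dist
    (P := fun u => toEuclideanThree (P u))
    (f := f) (g := gE) hC (fun u => (hj u u).1.trans (by linarith))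
    (fun u => (hrot _).trans (by linarith [(hj u u).2.1]))
    (fun u v => by
      rw [← map_sub, inner_toEuclideanThree]
      have h1 := (hj u v).2.2.2
      have h2 : gE v 0 * (P u - P v).1 + gE v 1 * (P u - P v).2.1 + gE v 2 * (P u - P v).2.2 =
          (g v).2.1 * (P u - P v).1 - (g v).1 * (P u - P v).2.1 := by
        simp [gE, toEuclideanThree_apply]; ring
      rw [h2]
      refine h1.trans ?_
      have h3 := norm_le_norm_toEuclideanThree (P u - P v)
      gcongr
      linarith)
    (fun u v => by
      rw [← map_sub, ← map_sub]
      have h1 : (((g u).2.1, -(g u).1, 0) - ((g v).2.1, -(g v).1, 0) : ℝ × ℝ × ℝ) =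
          ((g u - g v).2.1, -(g u - g v).1, 0) := by
        ext <;> simp; ring
      rw [h1]
      refine (hrot _).trans ?_
      have h2 := (hj u v).2.2.1
      have h3 := norm_le_norm_toEuclideanThree (P u - P v)
      have h4 : C / 4 * ‖P u - P v‖ ≤ C / 4 * ‖toEuclideanThree (P u - P v)‖ := by gcongr
      nlinarith [norm_nonneg (toEuclideanThree (P u - P v))])
    (Z := {w | R ≤ |w 1| ∨ R ≤ |w 2|})
    (fun u w hw => by
      obtain ⟨h1, h2⟩ := hYZ u
      rcases hw with hw | hw
      · have h3 := abs_apply_le_norm (toEuclideanThree (P u) - w) 1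
        have h4 : (toEuclideanThree (P u) - w) 1 = (H (s, u)).2.1 - w 1 := rfl
        rw [h4, abs_sub_comm] at h3
        have := abs_sub_abs_le_abs_sub (w 1) (H (s, u)).2.1
        linarith
      · have h3 := abs_apply_le_norm (toEuclideanThree (P u) - w) 2
        have h4 : (toEuclideanThree (P u) - w) 2 = (H (s, u)).2.2 - w 2 := rfl
        rw [h4, abs_sub_comm] at h3
        have := abs_sub_abs_le_abs_sub (w 2) (H (s, u)).2.2
        linarith)
  have hblip := norm_gradient_sub_le hT
  have hbc := continuous_of_taylor hT
  have hsmall : ∀ w, |S w| ≤ ε ∧ ‖b w‖ ≤ 1 / 2 := by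
    intro w
    by_cases hw : R ≤ |w 1|
    · obtain ⟨h1, h2⟩ := hZ w (Or.inl hw)
      rw [h1, h2]; simp [hε.le]
    push Not at hw
    set w₀ : EuclideanSpace ℝ (Fin 3) := toEuclideanThree (w 0, R, w 2)
    obtain ⟨h1, h2⟩ := hZ w₀ (Or.inl (le_abs_self R))
    have h3 : w - w₀ = toEuclideanThree (0, w 1 - R, 0) := by
      ext i; fin_cases i <;> simp [w₀, toEuclideanThree_apply]
    have h4 : ‖w - w₀‖ ≤ 2 * R := by
      rw [h3]
      refine (norm_toEuclideanThree_le _).trans ?_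
      simp only [abs_zero, zero_add, add_zero]
      rw [abs_lt] at hw
      rw [abs_le]; constructor <;> linarith
    constructor
    · have h5 := hT w₀ (w - w₀)
      rw [h1, h2, add_sub_cancel, inner_zero_left, sub_zero, sub_zero] at h5
      refine h5.trans ?_
      calc _ ≤ 12 * C * (2 * R) ^ 2 := by gcongr
        _ ≤ ε := by linarith
    · have h5 := hblip w w₀
      rw [h2, sub_zero] at h5
      refine h5.trans ?_
      calc _ ≤ 6 * (12 * C) * (2 * R) := by gcongr
        _ ≤ _ := by linarith
  refine ⟨fun p => S (toEuclideanThree p),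
    fun p => (innerSL ℝ (b (toEuclideanThree p))).comp toEuclideanThree, ?_, ?_⟩
  · have hap : ∀ p q, ((innerSL ℝ (b (toEuclideanThree p))).comp toEuclideanThree) q =
        b (toEuclideanThree p) 0 * q.1 + b (toEuclideanThree p) 1 * q.2.1 +
          b (toEuclideanThree p) 2 * q.2.2 := fun p q => inner_toEuclideanThree _ _
    refine ⟨fun p => ?_, ?_, fun x q => ?_, fun p => (hsmall _).1, fun p => ?_, fun p => ?_,
      fun p => ?_⟩
    · exact (hasFDerivAt_of_taylor hT _).comp p toEuclideanThree.hasFDerivAt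
    · fun_prop
    · have h1 : toEuclideanThree (x + 2 * π, q) =
          toEuclideanThree (x, q) + toEuclideanThree (2 * π, 0) := by
        rw [← map_add]; simp
      rw [h1]
      refine hτ _ (Equiv.addRight (2 * π)) (fun u => ?_) (fun w => ?_) _
      · have e1 := h.equivariant s hs u
        have e2 := h.equivariant t ht u
        have e3 : P (u + 2 * π) = P u + (2 * π, 0) := by simp [P, e1, e2]
        have e4 : g (u + 2 * π) = g u := by simp [g, e1, e2]
        refine ⟨by simp [e3], ?_, by simp [gE, e4]⟩
        simp [f, e4, e1]
      · simp [toEuclideanThree_apply]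
    all_goals
      rw [hap]
      simpa using (abs_apply_le_norm _ _).trans (hsmall _).2
  · intro x y z x' y' hL hy hx
    obtain ⟨u, hu⟩ := hL
    simp only [ContinuousLinearMap.comp_apply, innerSL_apply_apply, inner_toEuclideanThree,
      mul_zero, mul_one, zero_add, add_zero] at hy hx ⊢
    obtain ⟨hS1, hS2⟩ := hS u
    set q := toEuclideanThree (x', y', z) with hq
    have hXu : (H (s, u)).1 = x := congrArg Prod.fst hu
    have hYu : (H (s, u)).2.1 = y := congrArg (fun p => p.2.1) hu
    have hZu : (H (s, u)).2.2 = z := congrArg (fun p => p.2.2) hu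
    have hyB : |y| ≤ B := hYu ▸ (hYZ u).1
    have hd := hblip q (toEuclideanThree (P u))
    set d := ‖q - toEuclideanThree (P u)‖ with hdef
    rw [hS2] at hd
    have h1 : |b q 1 + (g u).1| ≤ 72 * C * d := by
      have e : (b q - gE u) 1 = b q 1 + (g u).1 := by simp [gE, toEuclideanThree_apply]
      rw [← e]
      exact (abs_apply_le_norm _ _).trans (hd.trans (le_of_eq (by ring)))
    have h2 : |b q 2| ≤ 72 * C * d := by
      have e : (b q - gE u) 2 = b q 2 := by simp [gE, toEuclideanThree_apply]
      rw [← e]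
      exact (abs_apply_le_norm _ _).trans (hd.trans (le_of_eq (by ring)))
    have e1 : x' - (H (t, u)).1 = -(b q 1 + (g u).1) := by
      simp only [g, Prod.fst_sub, hXu]; linarith
    have e2 : y' - y = b q 2 * y := by linarith
    have h3 : d ≤ |x' - (H (t, u)).1| + |y' - y| := by
      rw [hdef, hq, ← map_sub]
      refine (norm_toEuclideanThree_le _).trans (le_of_eq ?_)
      simp [P, hYu, hZu]
    have h4 : d ≤ 72 * C * d + 72 * C * d * B := by
      refine h3.trans ?_
      rw [e1, e2, abs_neg, abs_mul]
      gcongr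
    have hd0 : d = 0 := by
      have : 0 ≤ d := norm_nonneg _
      nlinarith
    have hqP : q = toEuclideanThree (P u) := by
      rwa [hdef, norm_eq_zero, sub_eq_zero] at hd0
    have e3 : x' = (H (t, u)).1 := by
      rw [hd0, mul_zero] at h1
      have := abs_nonpos_iff.1 h1
      rw [this] at e1
      linarith
    have e4 : y' = y := by
      rw [hd0, mul_zero] at h2
      have := abs_nonpos_iff.1 h2
      rw [this] at e2
      linarith
    refine ⟨u, ?_⟩
    rw [hqP, hS1, hS2]
    have e5 : gE u 0 = (g u).2.1 := by simp [gE, toEuclideanThree_apply]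
    rw [e5]
    refine Prod.ext e3.symm (Prod.ext ?_ ?_)
    · simp only [g, Prod.fst_sub, Prod.snd_sub, hYu, e4]; ring
    · simp only [f, g, Prod.fst_sub, Prod.snd_sub, hYu, hZu, hXu, e4, e3]; ring

/-- `F` is a `C¹` generating family for `L`, quadratic with signs `σ` up to a bounded error in the
fibre variables indexed by `U` and independent of the other ones. -/
structure IsGenerating {ι : Type*} [Fintype ι] [DecidableEq ι] (σ : ι → ℝ) (U : Finset ι)
    (F : ℝ × (ι → ℝ) → ℝ) (F' : ℝ × (ι → ℝ) → (ℝ × (ι → ℝ) →L[ℝ] ℝ)) (L : Set (ℝ × ℝ × ℝ))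
    (c K : ℝ) : Prop where
  hasFDerivAt : ∀ p, HasFDerivAt F (F' p) p
  continuous_deriv : Continuous F'
  periodic : ∀ x v, F (x + 2 * π, v) = F (x, v)
  abs_sub_le : ∀ p, |F p - c - ∑ j ∈ U, σ j * p.2 j ^ 2| ≤ K
  gradient : ∃ m₀ > 0, ∃ C, (∀ p, |F' p (1, 0)| ≤ C) ∧
    ∀ p, ∀ j ∈ U, ∃ m ∈ Set.Icc m₀ C, |F' p (0, Pi.single j 1) - m * (σ j * p.2 j)| ≤ C
  deriv_eq_zero : ∀ p, ∀ j ∉ U, F' p (0, Pi.single j 1) = 0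
  mem_of_critical : ∀ p, (∀ j, F' p (0, Pi.single j 1) = 0) → (p.1, F' p (1, 0), F p) ∈ L

theorem clm_apply_triple (L : ℝ × ℝ × ℝ →L[ℝ] ℝ) (u v w : ℝ) :
    L (u, v, w) = u * L (1, 0, 0) + v * L (0, 1, 0) + w * L (0, 0, 1) := by
  have h : ((u, v, w) : ℝ × ℝ × ℝ) = u • (1, 0, 0) + v • (0, 1, 0) + w • (0, 0, 1) := by simp
  rw [h]
  simp only [map_add, map_smul, smul_eq_mul]

section Generating

variable {ι : Type*}

/-- The effect of a contact transformation with generating function `S` on generating families,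
using the new fibre variables `a` and `b`. -/
def stepFamily (a b : ι) (S : ℝ × ℝ × ℝ → ℝ) (F : ℝ × (ι → ℝ) → ℝ) (p : ℝ × (ι → ℝ)) : ℝ :=
  F (p.1 - p.2 a - p.2 b, p.2) + p.2 a ^ 2 - p.2 b ^ 2 +
    S (p.1, p.2 a - p.2 b, F (p.1 - p.2 a - p.2 b, p.2))

theorem abs_stepFamily_zero_sub_le {a b : ι} {F G : ℝ × (ι → ℝ) → ℝ} {ε : ℝ}
    (h : ∀ p, |F p - G p| ≤ ε) (p : ℝ × (ι → ℝ)) :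
    |stepFamily a b 0 F p - stepFamily a b 0 G p| ≤ ε := by
  convert h (p.1 - p.2 a - p.2 b, p.2) using 2
  simp only [stepFamily, Pi.zero_apply]
  ring

theorem abs_stepFamily_sub_zero_le {a b : ι} {S : ℝ × ℝ × ℝ → ℝ} {ε : ℝ} (h : ∀ q, |S q| ≤ ε)
    (F : ℝ × (ι → ℝ) → ℝ) (p : ℝ × (ι → ℝ)) :
    |stepFamily a b S F p - stepFamily a b 0 F p| ≤ ε := by
  simpa [stepFamily] using h _

variable [Fintype ι] [DecidableEq ι]

theorem isGenerating_const (σ : ι → ℝ) (c : ℝ) :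
    IsGenerating σ ∅ (fun _ => c) (fun _ => 0) {q | ∃ x, q = (x, 0, c)} c 0 where
  hasFDerivAt p := hasFDerivAt_const c p
  continuous_deriv := continuous_const
  periodic _ _ := rfl
  abs_sub_le p := by simp
  gradient := ⟨1, one_pos, 0, by simp, by simp⟩
  deriv_eq_zero _ _ _ := rfl
  mem_of_critical p _ := ⟨p.1, rfl⟩

theorem IsGenerating.stepFamily {σ : ι → ℝ} {U : Finset ι} {F : ℝ × (ι → ℝ) → ℝ}
    {F' : ℝ × (ι → ℝ) → (ℝ × (ι → ℝ) →L[ℝ] ℝ)} {L L' : Set (ℝ × ℝ × ℝ)} {c K ε : ℝ}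
    (hF : IsGenerating σ U F F' L c K) {a b : ι} (hab : a ≠ b) (ha : a ∉ U) (hb : b ∉ U)
    (hσa : σ a = 1) (hσb : σ b = -1) {S : ℝ × ℝ × ℝ → ℝ} {S' : ℝ × ℝ × ℝ → (ℝ × ℝ × ℝ →L[ℝ] ℝ)}
    (hS : IsStep ε S S') (hL : Carries S S' L L') :
    ∃ G', IsGenerating σ (insert a (insert b U)) (stepFamily a b S F) G' L' c (K + ε) := by
  let π₂ : ι → ℝ × (ι → ℝ) →L[ℝ] ℝ := fun j =>
    (ContinuousLinearMap.proj j).comp (ContinuousLinearMap.snd ℝ ℝ (ι → ℝ))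
  let T : ℝ × (ι → ℝ) →L[ℝ] ℝ × (ι → ℝ) :=
    (ContinuousLinearMap.fst ℝ ℝ (ι → ℝ) - π₂ a - π₂ b).prod (ContinuousLinearMap.snd ℝ ℝ (ι → ℝ))
  let q : ℝ × (ι → ℝ) → ℝ × ℝ × ℝ := fun p => (p.1, p.2 a - p.2 b, F (T p))
  let G' : ℝ × (ι → ℝ) → (ℝ × (ι → ℝ) →L[ℝ] ℝ) := fun p =>
    (F' (T p)).comp T + (2 * p.2 a) • π₂ a - (2 * p.2 b) • π₂ b +
      (S' (q p)).comp ((ContinuousLinearMap.fst ℝ ℝ (ι → ℝ)).prod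
        ((π₂ a - π₂ b).prod ((F' (T p)).comp T)))
  have hTx : T (1, 0) = (1, 0) := by simp [T, π₂]
  have hTa : T (0, Pi.single a 1) = -(1, 0) + (0, Pi.single a 1) := by
    simp [T, π₂, hab.symm]
  have hTb : T (0, Pi.single b 1) = -(1, 0) + (0, Pi.single b 1) := by
    simp [T, π₂, hab]
  have hTj : ∀ j, j ≠ a → j ≠ b → T (0, Pi.single j 1) = (0, Pi.single j 1) := fun j h1 h2 => by
    simp [T, π₂, h1.symm, h2.symm]
  have hG' : ∀ p w, G' p w = F' (T p) (T w) + 2 * p.2 a * w.2 a - 2 * p.2 b * w.2 b +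
      (w.1 * S' (q p) (1, 0, 0) + (w.2 a - w.2 b) * S' (q p) (0, 1, 0) +
        F' (T p) (T w) * S' (q p) (0, 0, 1)) := fun p w => by
    rw [← clm_apply_triple]; rfl
  have hGx : ∀ p, G' p (1, 0) =
      (1 + S' (q p) (0, 0, 1)) * F' (T p) (1, 0) + S' (q p) (1, 0, 0) := fun p => by
    rw [hG', hTx]; simp; ring
  have hGa : ∀ p, G' p (0, Pi.single a 1) =
      -((1 + S' (q p) (0, 0, 1)) * F' (T p) (1, 0)) + 2 * p.2 a + S' (q p) (0, 1, 0) := fun p => by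
    rw [hG', hTa, map_add, map_neg, hF.deriv_eq_zero _ a ha]; simp [hab.symm]; ring
  have hGb : ∀ p, G' p (0, Pi.single b 1) =
      -((1 + S' (q p) (0, 0, 1)) * F' (T p) (1, 0)) - 2 * p.2 b - S' (q p) (0, 1, 0) := fun p => by
    rw [hG', hTb, map_add, map_neg, hF.deriv_eq_zero _ b hb]; simp [hab]; ring
  have hGj : ∀ p j, j ≠ a → j ≠ b → G' p (0, Pi.single j 1) =
      (1 + S' (q p) (0, 0, 1)) * F' (T p) (0, Pi.single j 1) := fun p j h1 h2 => by
    rw [hG', hTj j h1 h2]; simp [h1.symm, h2.symm]; ring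
  have hz : ∀ p, 1 / 2 ≤ 1 + S' p (0, 0, 1) ∧ 1 + S' p (0, 0, 1) ≤ 3 / 2 := fun p => by
    have := abs_le.1 (hS.abs_deriv_z_le p)
    constructor <;> linarith
  have hFc : Continuous F := continuous_iff_continuousAt.2 fun p => (hF.hasFDerivAt p).continuousAt
  refine ⟨G', ⟨fun p => ?_, ?_, fun x v => ?_, fun p => ?_, ?_, fun p j hj => ?_, fun p hp => ?_⟩⟩
  · have h1 : HasFDerivAt (fun p => F (T p)) ((F' (T p)).comp T) p :=
      (hF.hasFDerivAt (T p)).comp p T.hasFDerivAt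
    have h2 : ∀ j, HasFDerivAt (fun p : ℝ × (ι → ℝ) => p.2 j) (π₂ j) p := fun j =>
      (π₂ j).hasFDerivAt
    have h3 : HasFDerivAt q ((ContinuousLinearMap.fst ℝ ℝ (ι → ℝ)).prod
        ((π₂ a - π₂ b).prod ((F' (T p)).comp T))) p :=
      hasFDerivAt_fst.prodMk (((h2 a).sub (h2 b)).prodMk h1)
    have h4 : ∀ j, HasFDerivAt (fun p : ℝ × (ι → ℝ) => p.2 j ^ 2) ((2 * p.2 j) • π₂ j) p :=
      fun j => by simpa using (h2 j).pow 2
    exact ((h1.add (h4 a)).sub (h4 b)).add ((hS.hasFDerivAt (q p)).comp p h3)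
  · have h1 := hF.continuous_deriv
    have h2 := hS.continuous_deriv
    have hq : Continuous q := by fun_prop
    have h3 : Continuous fun p => F' (T p) := h1.comp T.continuous
    have h4 : Continuous fun p => (ContinuousLinearMap.fst ℝ ℝ (ι → ℝ)).prod
        ((π₂ a - π₂ b).prod ((F' (T p)).comp T)) :=
      (ContinuousLinearMap.prodₗᵢ ℝ).continuous.comp (continuous_const.prodMk
        ((ContinuousLinearMap.prodₗᵢ ℝ).continuous.comp
          (continuous_const.prodMk (h3.clm_comp continuous_const))))
    have h5 := (h2.comp hq).clm_comp h4
    have h6 : Continuous fun p : ℝ × (ι → ℝ) => (2 * p.2 a) • π₂ a := by fun_prop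
    have h7 : Continuous fun p : ℝ × (ι → ℝ) => (2 * p.2 b) • π₂ b := by fun_prop
    exact (((h3.clm_comp continuous_const).add h6).sub h7).add h5
  · have h1 : F (x + 2 * π - v a - v b, v) = F (x - v a - v b, v) := by
      rw [← hF.periodic (x - v a - v b) v]; congr 2; ring
    simp only [_root_.stepFamily, h1, hS.periodic]
  · have h1 := hF.abs_sub_le (T p)
    have h2 := hS.abs_le (q p)
    rw [Finset.sum_insert (by simp [hab, ha]), Finset.sum_insert hb, hσa, hσb]
    have e : _root_.stepFamily a b S F p - c -
        (1 * p.2 a ^ 2 + (-1 * p.2 b ^ 2 + ∑ j ∈ U, σ j * p.2 j ^ 2)) =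
        (F (T p) - c - ∑ j ∈ U, σ j * (T p).2 j ^ 2) + S (q p) := by
      have e1 : _root_.stepFamily a b S F p = F (T p) + p.2 a ^ 2 - p.2 b ^ 2 + S (q p) := rfl
      have e2 : (T p).2 = p.2 := rfl
      rw [e1, e2]; ring
    rw [e]
    exact (abs_add_le _ _).trans (add_le_add h1 h2)
  · obtain ⟨m₀, hm₀, C, hx, hC⟩ := hF.gradient
    have hC0 : 0 ≤ C := (abs_nonneg _).trans (hx 0)
    have hFx : ∀ p, |(1 + S' (q p) (0, 0, 1)) * F' (T p) (1, 0)| ≤ 3 / 2 * C := fun p => by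
      rw [abs_mul, abs_of_nonneg (by linarith [(hz (q p)).1])]
      exact mul_le_mul (hz _).2 (hx _) (abs_nonneg _) (by norm_num)
    refine ⟨min (m₀ / 2) 2, by positivity, 3 / 2 * C + 2, fun p => ?_, fun p j hj => ?_⟩
    · rw [hGx]
      refine (abs_add_le _ _).trans ?_
      linarith [hFx p, hS.abs_deriv_x_le (q p)]
    · have h1 := abs_le.1 (hFx p)
      have h2 := abs_le.1 (hS.abs_deriv_y_le (q p))
      by_cases hja : j = a
      · subst hja
        refine ⟨2, ⟨min_le_right _ _, by linarith⟩, ?_⟩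
        rw [hGa, hσa, abs_le]
        constructor <;> linarith
      by_cases hjb : j = b
      · subst hjb
        refine ⟨2, ⟨min_le_right _ _, by linarith⟩, ?_⟩
        rw [hGb, hσb, abs_le]
        constructor <;> linarith
      have hjU : j ∈ U := by simpa [hja, hjb] using hj
      obtain ⟨m, hm, hm'⟩ := hC (T p) j hjU
      obtain ⟨hz1, hz2⟩ := hz (q p)
      refine ⟨(1 + S' (q p) (0, 0, 1)) * m, ⟨?_, ?_⟩, ?_⟩
      · refine (min_le_left _ _).trans ?_
        nlinarith [hm.1]
      · nlinarith [hm.1, hm.2]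
      · rw [hGj p j hja hjb, mul_assoc, ← mul_sub, abs_mul, abs_of_nonneg (by linarith)]
        have h3 : (T p).2 = p.2 := rfl
        rw [h3] at hm'
        have := mul_le_mul hz2 hm' (abs_nonneg _) (by norm_num)
        linarith
  · simp only [Finset.mem_insert, not_or] at hj
    rw [hGj p j hj.1 hj.2.1, hF.deriv_eq_zero _ j hj.2.2, mul_zero]
  · have h1 : ∀ j, F' (T p) (0, Pi.single j 1) = 0 := fun j => by
      by_cases hja : j = a
      · exact hja ▸ hF.deriv_eq_zero _ a ha
      by_cases hjb : j = b
      · exact hjb ▸ hF.deriv_eq_zero _ b hb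
      have := hp j
      rw [hGj p j hja hjb] at this
      exact (mul_eq_zero.1 this).resolve_left (by linarith [(hz (q p)).1])
    have h2 := hF.mem_of_critical (T p) h1
    have h3 := hp a
    have h4 := hp b
    rw [hGa] at h3
    rw [hGb] at h4
    have hTp : (T p).1 = p.1 - p.2 a - p.2 b := rfl
    have h5 := hL _ _ _ p.1 (p.2 a - p.2 b) h2 (by change _ = (1 + S' (q p) _) * _; linarith)
      (by change _ = -S' (q p) _; rw [hTp]; linarith)
    convert h5 using 2
    refine Prod.ext ?_ ?_
    · change G' p (1, 0) = p.2 a - p.2 b + S' (q p) (1, 0, 0)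
      rw [hGx]; linarith
    · change F (T p) + p.2 a ^ 2 - p.2 b ^ 2 + S (q p) =
        F (T p) + (p.2 a - p.2 b) * (p.1 - (T p).1) + S (q p)
      rw [hTp]; ring

/-- The difference of two generating families in complementary fibre variables is tame. -/
theorem IsGenerating.isTame_sub {σ : ι → ℝ} {U V : Finset ι} (hU : ∀ j, j ∈ U ↔ j ∉ V)
    {F G : ℝ × (ι → ℝ) → ℝ} {F' G' : ℝ × (ι → ℝ) → (ℝ × (ι → ℝ) →L[ℝ] ℝ)}
    {L M : Set (ℝ × ℝ × ℝ)} {c d K : ℝ}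
    (hF : IsGenerating σ U F F' L c K) (hG : IsGenerating (-σ) V G G' M d K) :
    IsTame σ (fun p => F p - G p) (fun p => F' p - G' p) ∧
      (∀ p, |F p - G p - (c - d) - ∑ j, σ j * p.2 j ^ 2| ≤ 2 * K) ∧
      ∀ p, F' p - G' p = 0 → ∃ x y z w, (x, y, z) ∈ L ∧ (x, y, w) ∈ M ∧ F p - G p = z - w := by
  have hb : ∀ p, |F p - G p - (c - d) - ∑ j, σ j * p.2 j ^ 2| ≤ 2 * K := fun p => by
    have h1 := abs_le.1 (hF.abs_sub_le p)
    have h2 := abs_le.1 (hG.abs_sub_le p)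
    have h3 : ∑ j, σ j * p.2 j ^ 2 = ∑ j ∈ U, σ j * p.2 j ^ 2 + ∑ j ∈ V, σ j * p.2 j ^ 2 := by
      have : V = Uᶜ := by ext j; simp [hU]
      rw [this, Finset.sum_add_sum_compl]
    simp only [Pi.neg_apply, neg_mul, Finset.sum_neg_distrib] at h2
    rw [h3, abs_le]
    constructor <;> linarith
  refine ⟨⟨fun p => (hF.hasFDerivAt p).sub (hG.hasFDerivAt p),
    hF.continuous_deriv.sub hG.continuous_deriv, fun x v => ?_, ⟨2 * K + |c - d|, fun p => ?_⟩, ?_⟩,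
    hb, fun p hp => ?_⟩
  · rw [hF.periodic, hG.periodic]
  · have h1 := abs_le.1 (hb p)
    have h2 := le_abs_self (c - d)
    have h3 := neg_abs_le (c - d)
    rw [abs_le]
    constructor <;> linarith
  · obtain ⟨m₁, hm₁, C₁, hx₁, hC₁⟩ := hF.gradient
    obtain ⟨m₂, hm₂, C₂, hx₂, hC₂⟩ := hG.gradient
    have h1 : 0 ≤ C₁ := (abs_nonneg _).trans (hx₁ 0)
    have h2 : 0 ≤ C₂ := (abs_nonneg _).trans (hx₂ 0)
    refine ⟨min m₁ m₂, by positivity, C₁ + C₂, fun p => ?_, fun p j => ?_⟩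
    · exact (abs_sub _ _).trans (add_le_add (hx₁ p) (hx₂ p))
    · rw [sub_apply]
      by_cases hj : j ∈ V
      · obtain ⟨m, hm, hm'⟩ := hC₂ p j hj
        refine ⟨m, ⟨(min_le_right _ _).trans hm.1, by linarith [hm.2]⟩, ?_⟩
        rw [hF.deriv_eq_zero p j (fun h => (hU j).1 h hj), ← abs_neg]
        refine le_trans (le_of_eq ?_) (hm'.trans (by linarith))
        congr 1
        simp only [Pi.neg_apply]; ring
      · obtain ⟨m, hm, hm'⟩ := hC₁ p j ((hU j).2 hj)
        refine ⟨m, ⟨(min_le_left _ _).trans hm.1, by linarith [hm.2]⟩, ?_⟩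
        rw [hG.deriv_eq_zero p j hj, sub_zero]
        exact hm'.trans (by linarith)
  · have h1 : ∀ w, F' p w = G' p w := fun w => by
      rw [sub_eq_zero.1 hp]
    have h2 : ∀ j, F' p (0, Pi.single j 1) = 0 := fun j => by
      by_cases hj : j ∈ V
      · exact hF.deriv_eq_zero p j (fun h => (hU j).1 h hj)
      · rw [h1]; exact hG.deriv_eq_zero p j hj
    refine ⟨p.1, F' p (1, 0), F p, G p, hF.mem_of_critical p h2, ?_, rfl⟩
    rw [h1]
    exact hG.mem_of_critical p fun j => by rw [← h1]; exact h2 j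

end Generating

/-- The generating family obtained from a constant by a sequence of steps. -/
def chainFamily {ι : Type*} (a b : ℕ → ι) (S : ℕ → ℝ × ℝ × ℝ → ℝ) (c : ℝ) :
    ℕ → ℝ × (ι → ℝ) → ℝ
  | 0 => fun _ => c
  | n + 1 => stepFamily (a n) (b n) (S n) (chainFamily a b S c n)

/-- Truncation of a sequence of functions after `k` terms. -/
def truncSeq {α β : Type*} [Zero β] (k : ℕ) (S : ℕ → α → β) (i : ℕ) : α → β :=
  if i < k then S i else 0

theorem abs_chainFamily_truncSeq_succ_sub_le {ι : Type*} (a b : ℕ → ι) {S : ℕ → ℝ × ℝ × ℝ → ℝ}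
    (c : ℝ) {ε : ℝ} (hε : 0 ≤ ε) (hS : ∀ i q, |S i q| ≤ ε) (k n : ℕ) (p : ℝ × (ι → ℝ)) :
    |chainFamily a b (truncSeq (k + 1) S) c n p - chainFamily a b (truncSeq k S) c n p| ≤ ε := by
  have heq : ∀ n ≤ k, chainFamily a b (truncSeq (k + 1) S) c n =
      chainFamily a b (truncSeq k S) c n := by
    intro n
    induction n with
    | zero => intro _; rfl
    | succ n ih =>
      intro hn
      have h1 : truncSeq (k + 1) S n = truncSeq k S n := by
        rw [truncSeq, truncSeq, if_pos (by omega), if_pos (by omega)]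
      rw [chainFamily, chainFamily, ih (by omega), h1]
  induction n generalizing p with
  | zero => simpa [chainFamily] using hε
  | succ n ih =>
    rcases lt_trichotomy n k with h | rfl | h
    · rw [heq (n + 1) h]; simpa using hε
    · rw [chainFamily, chainFamily, heq n le_rfl, truncSeq, truncSeq, if_pos (by omega),
        if_neg (by omega)]
      exact abs_stepFamily_sub_zero_le (hS n) _ p
    · rw [chainFamily, chainFamily, truncSeq, truncSeq, if_neg (by omega), if_neg (by omega)]
      exact abs_stepFamily_zero_sub_le ih p

theorem exists_isGenerating_chainFamily {N : ℕ} [NeZero N] {β : Bool} {σ : Fin N × Bool × Bool → ℝ}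
    (hσ₁ : ∀ i, σ (i, false, β) = 1) (hσ₂ : ∀ i, σ (i, true, β) = -1)
    {S : ℕ → ℝ × ℝ × ℝ → ℝ} {S' : ℕ → ℝ × ℝ × ℝ → (ℝ × ℝ × ℝ →L[ℝ] ℝ)} {ε c : ℝ}
    (hS : ∀ i, IsStep ε (S i) (S' i)) {L : ℕ → Set (ℝ × ℝ × ℝ)}
    (hL₀ : L 0 = {q | ∃ x, q = (x, 0, c)}) (hL : ∀ i < N, Carries (S i) (S' i) (L i) (L (i + 1)))
    {n : ℕ} (hn : n ≤ N) :
    ∃ F', IsGenerating σ {j | j.2.2 = β ∧ j.1.val < n}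
      (chainFamily (fun i => (Fin.ofNat N i, false, β)) (fun i => (Fin.ofNat N i, true, β)) S c n)
      F' (L n) c (n * ε) := by
  induction n with
  | zero =>
    refine ⟨fun _ => 0, ?_⟩
    rw [hL₀]
    simpa [chainFamily] using isGenerating_const σ c
  | succ n ih =>
    obtain ⟨F', hF⟩ := ih (by omega)
    have hval : (Fin.ofNat N n).val = n := by simp [Nat.mod_eq_of_lt (show n < N by omega)]
    obtain ⟨G', hG⟩ := hF.stepFamily (a := (Fin.ofNat N n, false, β))
      (b := (Fin.ofNat N n, true, β)) (by simp)
      (by simp [Nat.mod_eq_of_lt (show n < N by omega)])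
      (by simp [Nat.mod_eq_of_lt (show n < N by omega)]) (hσ₁ _) (hσ₂ _) (hS n) (hL n (by omega))
    refine ⟨G', ?_⟩
    convert hG using 1
    · ext ⟨i, e, γ⟩
      simp only [Finset.mem_filter, Finset.mem_univ, true_and, Finset.mem_insert, Prod.mk.injEq,
        Fin.ext_iff, hval, Nat.lt_succ_iff]
      cases e <;> simp <;> grind
    · rfl
    · push_cast; ring

/-- The chords between two disjoint families of curves have lengths bounded below. -/
theorem IsLegendrianIsotopy.exists_le_chord {H₀ D₀ H₁ D₁ : ℝ × ℝ → ℝ × ℝ × ℝ}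
    (h₀ : IsLegendrianIsotopy H₀ D₀) (h₁ : IsLegendrianIsotopy H₁ D₁)
    (hdisj : ∀ t ∈ Set.Icc (0 : ℝ) 1, ∀ u v, H₁ (t, u) ≠ H₀ (t, v)) :
    ∃ δ > 0, ∀ t ∈ Set.Icc (0 : ℝ) 1, ∀ x y z w,
      (x, y, z) ∈ Set.range (fun u => H₁ (t, u)) → (x, y, w) ∈ Set.range (fun u => H₀ (t, u)) →
      δ ≤ |z - w| := by
  obtain ⟨B₀, hB₀, hb₀⟩ := h₀.exists_bound
  obtain ⟨B₁, hB₁, hb₁⟩ := h₁.exists_bound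
  have hc₀ := h₀.continuous
  have hc₁ := h₁.continuous
  obtain ⟨δ, hδ, hδ'⟩ := ((isCompact_Icc (a := (0 : ℝ)) (b := 1)).prod
    ((isCompact_Icc (a := (0 : ℝ)) (b := 2 * π)).prod
    (isCompact_Icc (a := -(B₀ + B₁)) (b := B₀ + B₁)))).exists_forall_le'
    (f := fun p => ‖H₁ (p.1, p.2.1) - H₀ (p.1, p.2.1 + p.2.2)‖)
    (by fun_prop) (a := 0) fun p hp => norm_pos_iff.2 (sub_ne_zero.2 (hdisj p.1 hp.1 _ _))
  refine ⟨δ, hδ, ?_⟩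
  rintro t ht x y z w ⟨u, hu⟩ ⟨v, hv⟩
  obtain ⟨k, hk⟩ := exists_mem_Icc_two_pi u
  have e₁ := Function.Periodic.int_mul (f := fun u => H₁ (t, u) - (u, 0, 0))
    (h₁.sub_periodic t ht) k u
  have e₀ := Function.Periodic.int_mul (f := fun u => H₀ (t, u) - (u, 0, 0))
    (h₀.sub_periodic t ht) k v
  simp only [sub_eq_iff_eq_add] at e₀ e₁ hu hv
  have l₁ := (norm_fst_le _).trans (hb₁ t ht u).2
  have l₀ := (norm_fst_le _).trans (hb₀ t ht v).2
  rw [hu] at l₁ e₁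
  rw [hv] at l₀ e₀
  simp only [Prod.fst_sub, Real.norm_eq_abs, abs_le] at l₀ l₁
  have h := hδ' (t, u + k * (2 * π), v - u) ⟨ht, hk, by constructor <;> simp only <;> linarith⟩
  have e : u + k * (2 * π) + (v - u) = v + k * (2 * π) := by ring
  simp only [e] at h
  rw [e₀, e₁] at h
  have e' : (x, y, z) - (u, 0, 0) + (u + k * (2 * π), 0, 0) -
      ((x, y, w) - (v, 0, 0) + (v + k * (2 * π), 0, 0)) = (0, 0, z - w) := by
    simp only [Prod.mk_sub_mk, Prod.mk_add_mk, Prod.mk.injEq]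
    refine ⟨by ring, by ring, by ring⟩
  rw [e'] at h
  simpa [Prod.norm_def] using h

theorem IsLegendrianIsotopy.exists_step_sequence {H D : ℝ × ℝ → ℝ × ℝ × ℝ}
    (h : IsLegendrianIsotopy H D) {ε : ℝ} (hε : 0 < ε) :
    ∃ N₀ : ℕ, ∀ N ≥ N₀, ∃ (S : ℕ → ℝ × ℝ × ℝ → ℝ)
      (S' : ℕ → ℝ × ℝ × ℝ → (ℝ × ℝ × ℝ →L[ℝ] ℝ)), (∀ i, IsStep ε (S i) (S' i)) ∧
      ∀ i < N, Carries (S i) (S' i) (Set.range fun u => H ((i : ℝ) / N, u))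
        (Set.range fun u => H (((i + 1 : ℕ) : ℝ) / N, u)) := by
  obtain ⟨δ, hδ, hstep⟩ := h.exists_step hε
  obtain ⟨n, hn⟩ := exists_nat_one_div_lt hδ
  refine ⟨n + 1, fun N hN => ?_⟩
  have hN0 : (0 : ℝ) < N := by exact_mod_cast (by omega : 0 < N)
  have key : ∀ i : ℕ, ∃ S S', IsStep ε S S' ∧ (i < N → Carries S S'
      (Set.range fun u => H ((i : ℝ) / N, u))
      (Set.range fun u => H (((i + 1 : ℕ) : ℝ) / N, u))) := by
    intro i
    by_cases hi : i < N
    · have hi' : ((i + 1 : ℕ) : ℝ) ≤ N := by exact_mod_cast hi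
      have hi'' : (i : ℝ) ≤ N := by exact_mod_cast hi.le
      obtain ⟨S, S', hS, hC⟩ := hstep (i / N) ⟨by positivity, (div_le_one hN0).2 hi''⟩
        ((i + 1 : ℕ) / N) ⟨by positivity, (div_le_one hN0).2 hi'⟩ (by
          rw [← sub_div, Nat.cast_add, Nat.cast_one, sub_add_cancel_left, abs_div, abs_neg, abs_one,
            abs_of_pos hN0]
          refine lt_of_le_of_lt ?_ hn
          gcongr
          exact_mod_cast hN)
      exact ⟨S, S', hS, fun _ => hC⟩
    · exact ⟨0, 0, isStep_zero hε.le, fun h => absurd h hi⟩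
  choose S S' hS using key
  exact ⟨S, S', fun i => (hS i).1, fun i => (hS i).2⟩

theorem carries_truncSeq {S : ℕ → ℝ × ℝ × ℝ → ℝ} {S' : ℕ → ℝ × ℝ × ℝ → (ℝ × ℝ × ℝ →L[ℝ] ℝ)}
    {L : ℕ → Set (ℝ × ℝ × ℝ)} {N : ℕ} (hL : ∀ i < N, Carries (S i) (S' i) (L i) (L (i + 1)))
    (k : ℕ) (i : ℕ) (hi : i < N) :
    Carries (truncSeq k S i) (truncSeq k S' i) (L (min i k)) (L (min (i + 1) k)) := by
  by_cases h : i < k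
  · rw [truncSeq, truncSeq, if_pos h, if_pos h, min_eq_left h.le, min_eq_left (by omega)]
    exact hL i hi
  · rw [truncSeq, truncSeq, if_neg h, if_neg h, min_eq_right (by omega), min_eq_right (by omega)]
    exact carries_zero _

theorem isStep_truncSeq {S : ℕ → ℝ × ℝ × ℝ → ℝ} {S' : ℕ → ℝ × ℝ × ℝ → (ℝ × ℝ × ℝ →L[ℝ] ℝ)}
    {ε : ℝ} (hε : 0 ≤ ε) (hS : ∀ i, IsStep ε (S i) (S' i)) (k i : ℕ) :
    IsStep ε (truncSeq k S i) (truncSeq k S' i) := by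
  rw [truncSeq, truncSeq]
  split_ifs
  · exact hS i
  · exact isStep_zero hε

/-- Two disjoint Legendrian isotopies starting at the zero section and its translate cannot
interchange them. -/
theorem IsLegendrianIsotopy.not_swap {H₀ D₀ H₁ D₁ : ℝ × ℝ → ℝ × ℝ × ℝ}
    (h₀ : IsLegendrianIsotopy H₀ D₀) (h₁ : IsLegendrianIsotopy H₁ D₁)
    (hdisj : ∀ t ∈ Set.Icc (0 : ℝ) 1, ∀ u v, H₁ (t, u) ≠ H₀ (t, v))
    (hstart₀ : Set.range (fun u => H₀ (0, u)) = {q | ∃ x, q = (x, 0, 0)})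
    (hstart₁ : Set.range (fun u => H₁ (0, u)) = {q | ∃ x, q = (x, 0, 1)})
    (hend₀ : Set.range (fun u => H₀ (1, u)) = {q | ∃ x, q = (x, 0, 1)})
    (hend₁ : Set.range (fun u => H₁ (1, u)) = {q | ∃ x, q = (x, 0, 0)}) : False := by
  obtain ⟨δ, hδ, hchord⟩ := h₀.exists_le_chord h₁ hdisj
  have hδ1 : δ ≤ 1 := by
    have := hchord 0 ⟨le_rfl, zero_le_one⟩ 0 0 1 0 (by rw [hstart₁]; exact ⟨0, rfl⟩)
      (by rw [hstart₀]; exact ⟨0, rfl⟩)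
    simpa using this
  have hε : 0 < δ / 4 := by positivity
  obtain ⟨N₀, hN₀⟩ := h₀.exists_step_sequence hε
  obtain ⟨N₁, hN₁⟩ := h₁.exists_step_sequence hε
  set N := N₀ + N₁ + 1
  obtain ⟨S₀, S₀', hS₀, hC₀⟩ := hN₀ N (by omega)
  obtain ⟨S₁, S₁', hS₁, hC₁⟩ := hN₁ N (by omega)
  have hN : (0 : ℝ) < N := by positivity
  let σ : Fin N × Bool × Bool → ℝ := fun j => if j.2.1 = j.2.2 then -1 else 1
  have hσ : ∀ j, σ j = 1 ∨ σ j = -1 := fun j => by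
    simp only [σ]; split_ifs <;> simp
  let chain : Bool → (ℕ → ℝ × ℝ × ℝ → ℝ) → ℝ → ℝ × (Fin N × Bool × Bool → ℝ) → ℝ := fun β S c =>
    chainFamily (fun i => (Fin.ofNat N i, false, β)) (fun i => (Fin.ofNat N i, true, β)) S c N
  let G : ℕ → ℝ × (Fin N × Bool × Bool → ℝ) → ℝ := fun k p =>
    chain true (truncSeq k S₁) 1 p - chain false (truncSeq k S₀) 0 p
  have hU : ∀ j : Fin N × Bool × Bool,
      j ∈ ({j | j.2.2 = true ∧ j.1.val < N} : Finset (Fin N × Bool × Bool)) ↔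
      j ∉ ({j | j.2.2 = false ∧ j.1.val < N} : Finset (Fin N × Bool × Bool)) := by
    rintro ⟨i, e, γ⟩; simp
  have hG : ∀ k ≤ N, ∃ G', IsTame σ (G k) G' ∧
      (∀ p, |G k p - (1 - 0) - ∑ j, σ j * p.2 j ^ 2| ≤ 2 * (N * (δ / 4))) ∧
      ∀ p, G' p = 0 → ∃ x y z w, (x, y, z) ∈ Set.range (fun u => H₁ ((k : ℝ) / N, u)) ∧
        (x, y, w) ∈ Set.range (fun u => H₀ ((k : ℝ) / N, u)) ∧ G k p = z - w := by
    intro k hk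
    obtain ⟨F₁', hF₁⟩ := exists_isGenerating_chainFamily (N := N) (β := true) (σ := σ)
      (by simp [σ]) (by simp [σ]) (isStep_truncSeq hε.le hS₁ k)
      (L := fun i => Set.range fun u => H₁ ((min i k : ℕ) / N, u)) (c := 1)
      (by simpa using hstart₁)
      (carries_truncSeq (L := fun i => Set.range fun u => H₁ ((i : ℝ) / N, u)) hC₁ k) le_rfl
    obtain ⟨F₀', hF₀⟩ := exists_isGenerating_chainFamily (N := N) (β := false) (σ := -σ)
      (by simp [σ]) (by simp [σ]) (isStep_truncSeq hε.le hS₀ k)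
      (L := fun i => Set.range fun u => H₀ ((min i k : ℕ) / N, u)) (c := 0)
      (by simpa using hstart₀)
      (carries_truncSeq (L := fun i => Set.range fun u => H₀ ((i : ℝ) / N, u)) hC₀ k) le_rfl
    have h := hF₁.isTame_sub hU hF₀
    simp only [min_eq_right hk] at h
    exact ⟨fun p => F₁' p - F₀' p, h⟩
  have hpush : ∀ k ≤ N, ∃ h, IsAdmissible σ h ∧ ∀ w, G k (h w) ≤ -δ / 2 := by
    intro k hk
    induction hk using Nat.decreasingInduction with
    | self =>
      obtain ⟨G', hT, hb, hcrit⟩ := hG N le_rfl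
      refine hT.exists_pushed_down hσ (a := -(3 * δ / 4)) (b := 1 + 2 * (N * (δ / 4)))
        (a' := -δ / 2) (h := fun w => (0, fun j => if σ j = -1 then w j else 0)) ?_ (by linarith)
        ?_ ⟨?_, 0, ?_⟩ fun w => ?_
      · have : 0 < N * (δ / 4) := by positivity
        linarith
      · intro p hp h0
        obtain ⟨x, y, z, w, hz, hw, hzw⟩ := hcrit p h0
        rw [div_self hN.ne', hend₁] at hz
        rw [div_self hN.ne', hend₀] at hw
        obtain ⟨_, hz⟩ := hz
        obtain ⟨_, hw⟩ := hw
        simp only [Prod.mk.injEq] at hz hw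
        rw [hzw, hz.2.2, hw.2.2] at hp
        linarith [hp.1]
      · refine continuous_const.prodMk (continuous_pi fun j => ?_)
        split_ifs <;> fun_prop
      · intro w j hj
        simp [hj]
      · have h1 := (abs_le.1 (hb (0, fun j => if σ j = -1 then w j else 0))).2
        have h2 : ∑ j, σ j * (if σ j = -1 then w j else 0) ^ 2 ≤ 0 := by
          refine Finset.sum_nonpos fun j _ => ?_
          split_ifs with hj
          · rw [hj]; nlinarith [sq_nonneg (w j)]
          · simp
        simp only at h1
        linarith
    | of_succ k hk ih =>
      obtain ⟨h, hh, hle⟩ := ih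
      obtain ⟨G', hT, hb, hcrit⟩ := hG k (by omega)
      refine hT.exists_pushed_down hσ (a := -(3 * δ / 4)) (b := 0) (by linarith) (by linarith) ?_
        hh fun w => ?_
      · intro p hp h0
        obtain ⟨x, y, z, w, hz, hw, hzw⟩ := hcrit p h0
        have hk' : (k : ℝ) ≤ N := by exact_mod_cast (by omega : k ≤ N)
        have := hchord (k / N) ⟨by positivity, (div_le_one hN).2 hk'⟩ x y z w hz hw
        rw [← hzw, abs_of_nonpos hp.2] at this
        linarith [hp.1]
      · have h1 := abs_le.1 (abs_chainFamily_truncSeq_succ_sub_le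
          (fun i => (Fin.ofNat N i, false, true)) (fun i => (Fin.ofNat N i, true, true)) 1 hε.le
          (fun i => (hS₁ i).abs_le) k N (h w))
        have h2 := abs_le.1 (abs_chainFamily_truncSeq_succ_sub_le
          (fun i => (Fin.ofNat N i, false, false)) (fun i => (Fin.ofNat N i, true, false)) 0 hε.le
          (fun i => (hS₀ i).abs_le) k N (h w))
        have h3 := hle w
        simp only [G, chain] at h3 ⊢
        linarith
  obtain ⟨h, hh, hle⟩ := hpush 0 (Nat.zero_le _)
  obtain ⟨w, hw⟩ := hh.exists_nonneg hσ
  have hzero : ∀ (S : ℕ → ℝ × ℝ × ℝ → ℝ), truncSeq 0 S = fun _ => 0 := fun S => by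
    ext; simp [truncSeq]
  obtain ⟨F₁', hF₁⟩ := exists_isGenerating_chainFamily (N := N) (β := true) (σ := σ)
    (by simp [σ]) (by simp [σ]) (fun _ => isStep_zero le_rfl) (c := 1)
    (L := fun _ => {q | ∃ x, q = (x, 0, 1)}) rfl (fun _ _ => carries_zero _) le_rfl
  obtain ⟨F₀', hF₀⟩ := exists_isGenerating_chainFamily (N := N) (β := false) (σ := -σ)
    (by simp [σ]) (by simp [σ]) (fun _ => isStep_zero le_rfl) (c := 0)
    (L := fun _ => {q | ∃ x, q = (x, 0, 0)}) rfl (fun _ _ => carries_zero _) le_rfl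
  have h1 := (hF₁.isTame_sub hU hF₀).2.1 (h w)
  have h2 := hle w
  simp only [G, chain, hzero] at h2
  have h3 := (abs_le.1 h1).1
  simp only [mul_zero] at h3
  linarith

theorem isLegendrianIsotopy_of_contDiff {H : ℝ × ℝ → ℝ × ℝ × ℝ} (hH : ContDiff ℝ (⊤ : ℕ∞) H)
    (h : ∀ t ∈ Set.Icc (0 : ℝ) 1, LegendrianKnot fun x => H (t, x)) :
    IsLegendrianIsotopy H fun p => fderiv ℝ H p (0, 1) := by
  have hder : ∀ t u, HasDerivAt (fun u => H (t, u)) (fderiv ℝ H (t, u) (0, 1)) u := fun t u =>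
    ((hH.differentiable (by simp)) (t, u)).hasFDerivAt.comp_hasDerivAt u
      ((hasDerivAt_const u t).prodMk (hasDerivAt_id u))
  refine ⟨hH.continuous, (hH.continuous_fderiv (by simp)).clm_apply continuous_const, hder,
    fun t ht => (h t ht).1.1.2, fun t ht u => ?_, fun t ht u v huv => ?_, fun t ht u => ?_⟩
  · rw [← (hder t u).deriv]
    exact (h t ht).1.2.1 u
  · obtain ⟨k, hk⟩ := (h t ht).1.2.2 u v huv
    have hper : Function.Periodic (fun u => H (t, u) - (u, 0, 0)) (2 * π) := fun u => by
      have e := (h t ht).1.1.2 u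
      simp only at e ⊢
      rw [e]
      ext <;> simp
    have e := hper.int_mul k v
    rw [show v + k * (2 * π) = u by linarith] at e
    simp only at e huv
    rw [huv] at e
    simpa using e
  · have e := (h t ht).2 u
    rwa [(hder t u).snd_comp.snd_comp.deriv, (hder t u).fst_comp.deriv] at e

/-- Traynor: there is NO Legendrian isotopy of ordered Legendrian
links from `(Λ₀, Λ₁)` to `(Λ₁, Λ₀)`, where `Λ₀(x) = (x,0,0)` and `Λ₁(x) = (x,0,1)`. -/
theorem traynor_no_legendrian_swap :
    ¬ ∃ H₀ H₁ : ℝ × ℝ → ℝ × ℝ × ℝ,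
      ContDiff ℝ (⊤ : ℕ∞) H₀ ∧ ContDiff ℝ (⊤ : ℕ∞) H₁ ∧
      (∀ t ∈ Set.Icc (0 : ℝ) 1,
        OrderedLegendrianLink (fun x => H₀ (t, x)) (fun x => H₁ (t, x))) ∧
      (fun x => H₀ (0, x)) = (fun x : ℝ => (x, (0 : ℝ), (0 : ℝ))) ∧
      (fun x => H₁ (0, x)) = (fun x : ℝ => (x, (0 : ℝ), (1 : ℝ))) ∧
      Set.range (fun x => H₀ (1, x)) = {p : ℝ × ℝ × ℝ | ∃ x : ℝ, p = (x, 0, 1)} ∧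
      Set.range (fun x => H₁ (1, x)) = {p : ℝ × ℝ × ℝ | ∃ x : ℝ, p = (x, 0, 0)} := by
  rintro ⟨H₀, H₁, hH₀, hH₁, hlink, hstart₀, hstart₁, hend₀, hend₁⟩
  refine (isLegendrianIsotopy_of_contDiff hH₀ fun t ht => (hlink t ht).1).not_swap
    (isLegendrianIsotopy_of_contDiff hH₁ fun t ht => (hlink t ht).2.1)
    (fun t ht u v huv => ?_) ?_ ?_ hend₀ hend₁
  · exact Set.disjoint_left.1 (hlink t ht).2.2 ⟨v, rfl⟩ ⟨u, huv⟩
  · rw [hstart₀]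
    ext q
    simp [eq_comm]
  · rw [hstart₁]
    ext q
    simp [eq_comm]
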